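/- Let B be a block of a profinite group G with defect group D ≅ Z_p. Then every indecomposable projective B-module is pro-uniserial, i.e., all of its coinvariant quotients at open normal subgroups in the chosen cofinal system are uniserial. -/

import Mathlib

open scoped Classical
set_option maxHeartbeats 1000000
set_option synthInstance.maxHeartbeats 400000

noncomputable section

namespace ProfiniteBlocks

variable (k : Type) [Field k] (G : Type) [Group G] [TopologicalSpace G]

/-- Discrete topology on each finite level group algebra. -/
instance (X : Type) : TopologicalSpace (MonoidAlgebra k X) := ⊥

/-- The canonical quotient homomorphism `G/N → G/M` for `N ≤ M`. -/
def qHom (N M : OpenNormalSubgroup G) (h : N ≤ M) :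
    G ⧸ N.toSubgroup →* G ⧸ M.toSubgroup :=
  QuotientGroup.map _ _ (MonoidHom.id G) (fun x hx => h hx)

/-- The induced algebra homomorphism `k[G/N] → k[G/M]` for `N ≤ M`. -/
def tHom (N M : OpenNormalSubgroup G) (h : N ≤ M) :
    MonoidAlgebra k (G ⧸ N.toSubgroup) →ₐ[k] MonoidAlgebra k (G ⧸ M.toSubgroup) :=
  MonoidAlgebra.mapDomainAlgHom k k (qHom G N M h)

/-- The completed group algebra `k⟦G⟧`, realized as the inverse limit of the finite
level group algebras `k[G/N]` over all open normal subgroups `N` of `G`, sitting inside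
their product. -/
def CGA : Subalgebra k (∀ N : OpenNormalSubgroup G, MonoidAlgebra k (G ⧸ N.toSubgroup)) where
  carrier := {x | ∀ (N M : OpenNormalSubgroup G) (h : N ≤ M), tHom k G N M h (x N) = x M}
  add_mem' hx hy N M h := by simp [map_add, hx N M h, hy N M h]
  mul_mem' hx hy N M h := by simp [map_mul, hx N M h, hy N M h]
  algebraMap_mem' r N M h := by
    simp [tHom, MonoidAlgebra.mapDomainAlgHom, MonoidAlgebra.mapDomainRingHom,
      Finsupp.mapDomain_single]

instance : Ring (CGA k G) := inferInstance
instance : Algebra k (CGA k G) := inferInstance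

/-- `k⟦G⟧` carries the inverse limit topology (each `k[G/N]` being discrete). -/
instance : TopologicalSpace (CGA k G) := inferInstanceAs (TopologicalSpace (Subtype _))

/-- The canonical (continuous) inclusion of `G` into `k⟦G⟧`. -/
def ofG : G →* CGA k G where
  toFun g := ⟨fun N => MonoidAlgebra.single ((g : G) : G ⧸ N.toSubgroup) 1, by
    intro N M h
    simp [tHom, MonoidAlgebra.mapDomainAlgHom, MonoidAlgebra.mapDomainRingHom,
      Finsupp.mapDomain_single, qHom, QuotientGroup.map_mk]
    rfl⟩
  map_one' := by
    ext N
    simp [MonoidAlgebra.one_def]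
  map_mul' g g' := by
    ext N
    simp [MonoidAlgebra.single_mul_single]


/-- The map between quotient modules induced by `f` (the canonical map whenever
`f` carries `P` into `Q`). -/
def mapQ' {R X Y : Type} [Ring R] [AddCommGroup X] [AddCommGroup Y] [Module R X]
    [Module R Y] (P : Submodule R X) (Q : Submodule R Y) (f : X →ₗ[R] Y) :
    (X ⧸ P) →ₗ[R] (Y ⧸ Q) :=
  if h : P ≤ Q.comap f then Submodule.mapQ P Q f h else 0

/-- The map between submodules induced by `f` (the canonical restriction whenever
`f` carries `P` into `Q`). -/
def restrict' {R X Y : Type} [Ring R] [AddCommGroup X] [AddCommGroup Y] [Module R X]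
    [Module R Y] (P : Submodule R X) (Q : Submodule R Y) (f : X →ₗ[R] Y) :
    P →ₗ[R] Q :=
  if h : ∀ x ∈ P, f x ∈ Q then f.restrict h else 0

/-- The subquotient `W / W'` of a module. -/
abbrev subQuot {R X : Type} [Ring R] [AddCommGroup X] [Module R X]
    (W W' : Submodule R X) : Type :=
  W ⧸ (W'.comap W.subtype)

/-- The radical of a topological module: the intersection of its maximal open
submodules. -/
def radical (R : Type) [Ring R] (X : Type) [AddCommGroup X] [Module R X]
    [TopologicalSpace X] : Submodule R X :=
  sInf {W : Submodule R X | IsCoatom W ∧ IsOpen (W : Set X)}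

/-- Iterated radicals `Rad^i(X)`, with `Rad^0(X) = X`. -/
def radPow (R : Type) [Ring R] (X : Type) [AddCommGroup X] [Module R X]
    [TopologicalSpace X] : ℕ → Submodule R X
  | 0 => ⊤
  | (n + 1) => (radical R (radPow R X n)).map (radPow R X n).subtype

/-- A topological module is semisimple if every closed submodule has a closed
complement. -/
def IsSemisimpleTop (R : Type) [Ring R] (X : Type) [AddCommGroup X] [Module R X]
    [TopologicalSpace X] : Prop :=
  ∀ W : Submodule R X, IsClosed (W : Set X) →
    ∃ W' : Submodule R X, IsClosed (W' : Set X) ∧ IsCompl W W'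

/-- The socle of a topological module: the largest closed semisimple submodule
(defined as the join of all closed semisimple submodules). -/
def socle (R : Type) [Ring R] (X : Type) [AddCommGroup X] [Module R X]
    [TopologicalSpace X] : Submodule R X :=
  sSup {W : Submodule R X | IsClosed (W : Set X) ∧ IsSemisimpleTop R W}

/-- A module is uniserial if its submodules form a chain. -/
def Uniserial (R : Type) [Ring R] (X : Type) [AddCommGroup X] [Module R X] : Prop :=
  ∀ W W' : Submodule R X, W ≤ W' ∨ W' ≤ W

/-- A topological module is (topologically) indecomposable if it is non-zero and
admits no non-trivial decomposition into closed direct summands. -/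
def IsIndecTop (R : Type) [Ring R] (X : Type) [AddCommGroup X] [Module R X]
    [TopologicalSpace X] : Prop :=
  Nontrivial X ∧ ∀ W W' : Submodule R X, IsClosed (W : Set X) → IsClosed (W' : Set X) →
    IsCompl W W' → W = ⊥ ∨ W' = ⊥

/-- The inverse limit of a compatible system of modules indexed by a preorder,
realized as the submodule of compatible families in the product. -/
def compatLim {ι : Type} [Preorder ι] {R : Type} [Ring R] (T : ι → Type)
    [∀ i, AddCommGroup (T i)] [∀ i, Module R (T i)]
    (t : ∀ i j, i ≤ j → (T i →ₗ[R] T j)) : Submodule R (∀ i, T i) where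
  carrier := {f | ∀ (i j : ι) (h : i ≤ j), t i j h (f i) = f j}
  add_mem' ha hb i j h := by simp only [Pi.add_apply, map_add]; rw [ha i j h, hb i j h]
  zero_mem' i j h := by simp
  smul_mem' c a ha i j h := by simp only [Pi.smul_apply, map_smul]; rw [ha i j h]

/-- `X` has exactly `n` composition factors (measured along the radical series). -/
def HasNFactors (R : Type) [Ring R] (X : Type) [AddCommGroup X] [Module R X]
    [TopologicalSpace X] (n : ℕ) : Prop :=
  radPow R X n = ⊥ ∧ ∀ m < n, radPow R X m ≠ ⊥

/-- `X` has infinitely many composition factors. -/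
def HasInfFactors (R : Type) [Ring R] (X : Type) [AddCommGroup X] [Module R X]
    [TopologicalSpace X] : Prop :=
  ∀ n : ℕ, radPow R X n ≠ ⊥



section Coinvariants

variable {k : Type} [Field k] {G : Type} [Group G] [TopologicalSpace G]

variable (k G) in
/-- The (closed) submodule `I_N U` of a topological `k⟦G⟧`-module `U`: the smallest
closed submodule containing all elements `n • u - u` for `n ∈ N`.  Its quotient is the
module of `N`-coinvariants. -/
def coinvKer (N : OpenNormalSubgroup G) (U : Type) [AddCommGroup U]
    [Module (CGA k G) U] [TopologicalSpace U] : Submodule (CGA k G) U :=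
  sInf {W : Submodule (CGA k G) U | IsClosed (W : Set U) ∧
    ∀ n ∈ N.toSubgroup, ∀ u : U, ofG k G n • u - u ∈ W}

variable (k G) in
/-- The module of `N`-coinvariants `U_N` of a topological `k⟦G⟧`-module `U`. -/
abbrev coinv (N : OpenNormalSubgroup G) (U : Type) [AddCommGroup U]
    [Module (CGA k G) U] [TopologicalSpace U] : Type :=
  U ⧸ coinvKer k G N U

variable (k G) in
/-- The canonical projection `φ_N : U → U_N`. -/
def phi (N : OpenNormalSubgroup G) (U : Type) [AddCommGroup U]
    [Module (CGA k G) U] [TopologicalSpace U] : U →ₗ[CGA k G] coinv k G N U :=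
  (coinvKer k G N U).mkQ

lemma coinvKer_mono {N M : OpenNormalSubgroup G} (h : N ≤ M) (U : Type) [AddCommGroup U]
    [Module (CGA k G) U] [TopologicalSpace U] : coinvKer k G N U ≤ coinvKer k G M U :=
  sInf_le_sInf (fun W hW => ⟨hW.1, fun n hn u => hW.2 n (h hn) u⟩)

variable (k G) in
/-- The canonical projection `φ_{MN} : U_N → U_M` for `N ≤ M`. -/
def phiT (N M : OpenNormalSubgroup G) (h : N ≤ M) (U : Type) [AddCommGroup U]
    [Module (CGA k G) U] [TopologicalSpace U] :
    coinv k G N U →ₗ[CGA k G] coinv k G M U :=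
  Submodule.mapQ _ _ LinearMap.id (fun _ hx => coinvKer_mono h U hx)

variable (k G) in
/-- `N` acts trivially on the `k⟦G⟧`-module `W`. -/
def NTrivial (N : OpenNormalSubgroup G) (W : Type) [AddCommGroup W]
    [Module (CGA k G) W] : Prop :=
  ∀ n ∈ N.toSubgroup, ∀ w : W, ofG k G n • w = w

end Coinvariants

section Pseudocompact

variable (k : Type) [Field k]

/-- A pseudocompact module over a topological `k`-algebra `A`: a Hausdorff topological
module possessing a basis of neighbourhoods of `0` consisting of open submodules of
finite codimension which intersect in `0`, and which is the inverse limit of the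
corresponding discrete quotients. -/
structure IsPseudocompactMod (A : Type) [Ring A] [Algebra k A] [TopologicalSpace A]
    (X : Type) [AddCommGroup X] [Module k X] [Module A X] [IsScalarTower k A X]
    [TopologicalSpace X] : Prop where
  t2 : T2Space X
  addGroup : IsTopologicalAddGroup X
  contSMul : ContinuousSMul A X
  basis : (nhds (0 : X)).HasBasis
    (fun V : Submodule A X => IsOpen (V : Set X) ∧
      FiniteDimensional k (X ⧸ V.restrictScalars k))
    (fun V => (V : Set X))
  inf_bot : (⨅ (V : Submodule A X) (_ : IsOpen (V : Set X) ∧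
      FiniteDimensional k (X ⧸ V.restrictScalars k)), V) = ⊥
  complete : ∀ c : ∀ V : {V : Submodule A X // IsOpen (V : Set X) ∧
      FiniteDimensional k (X ⧸ V.restrictScalars k)}, X ⧸ V.1,
    (∀ (V W : {V : Submodule A X // IsOpen (V : Set X) ∧
        FiniteDimensional k (X ⧸ V.restrictScalars k)}), V.1 ≤ W.1 →
      mapQ' V.1 W.1 LinearMap.id (c V) = c W) →
    ∃ x : X, ∀ V, c V = Submodule.Quotient.mk x

end Pseudocompact

section Blocks

variable (R : Type) [Ring R]

/-- A block idempotent: a centrally primitive idempotent of `R`. -/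
structure IsBlockIdem (e : R) : Prop where
  idem : IsIdempotentElem e
  ne_zero : e ≠ 0
  central : e ∈ Set.center R
  primitive : ∀ f g : R, f ∈ Set.center R → g ∈ Set.center R → IsIdempotentElem f →
    IsIdempotentElem g → f * g = 0 → g * f = 0 → e = f + g → f = 0 ∨ g = 0

/-- The block `B = Re` determined by a central idempotent `e`, as a left `R`-module. -/
def blockMod (e : R) (he : e ∈ Set.center R) : Submodule R R where
  carrier := {a : R | a * e = a}
  add_mem' := by intro a b ha hb; simp only [Set.mem_setOf_eq, add_mul] at *; rw [ha, hb]
  zero_mem' := by simp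
  smul_mem' := by
    intro c a ha
    simp only [Set.mem_setOf_eq, smul_eq_mul, mul_assoc] at *
    rw [ha]

/-- A module belongs to the block of the central idempotent `e` if `e` acts as the
identity on it. -/
def InBlock {X : Type} [AddCommGroup X] [Module R X] (e : R) : Prop :=
  ∀ x : X, e • x = x

end Blocks

section Defect

variable {k : Type} [Field k] {G : Type} [Group G] [TopologicalSpace G]

variable (k G) in
/-- The conjugation action of `G` on `k⟦G⟧`. -/
def conjAct (g : G) (x : CGA k G) : CGA k G :=
  ofG k G g * x * ofG k G g⁻¹

variable (k G) in
/-- The `H`-fixed points of `k⟦G⟧` under conjugation. -/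
def fixedBy (H : Subgroup G) : Set (CGA k G) :=
  {x : CGA k G | ∀ h ∈ H, conjAct k G h x = x}

variable (k G) in
/-- The relative trace map `Tr_H^G` on `k⟦G⟧` (a finite sum over coset
representatives when `H` is open). -/
def trMap (H : Subgroup G) (x : CGA k G) : CGA k G :=
  ∑ᶠ c : G ⧸ H, conjAct k G (Quotient.out c) x

variable (k G) in
/-- The image `Tr_H^G(k⟦G⟧^H)`. -/
def trImage (H : Subgroup G) : Set (CGA k G) :=
  trMap k G H '' fixedBy k G H

variable (k G) in
/-- `D` satisfies the defect property for `e`: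
`e ∈ ⋂_N Tr_{DN}^G (k⟦G⟧^{DN})`. -/
def DefectProp (e : CGA k G) (D : Subgroup G) : Prop :=
  ∀ N : OpenNormalSubgroup G, e ∈ trImage k G (D ⊔ N.toSubgroup)

variable (k G) in
/-- `D` is a defect group of the block of `e`: a closed subgroup, minimal subject to
the defect property. -/
structure IsDefectGroup (e : CGA k G) (D : Subgroup G) : Prop where
  closed : IsClosed (D : Set G)
  defect : DefectProp k G e D
  minimal : ∀ D' : Subgroup G, IsClosed ((D' : Set G)) → D' ≤ D →
    DefectProp k G e D' → D' = D

end Defect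

section FiniteDefect

variable (k : Type) [Field k] (Q : Type) [Group Q]

/-- Conjugation on a finite level group algebra `k[Q]`. -/
def conjActF (q : Q) (x : MonoidAlgebra k Q) : MonoidAlgebra k Q :=
  MonoidAlgebra.single q 1 * x * MonoidAlgebra.single q⁻¹ 1

/-- `H`-fixed points of `k[Q]` under conjugation. -/
def fixedByF (H : Subgroup Q) : Set (MonoidAlgebra k Q) :=
  {x | ∀ h ∈ H, conjActF k Q h x = x}

/-- The relative trace map `Tr_H^Q` on `k[Q]`. -/
def trMapF (H : Subgroup Q) (x : MonoidAlgebra k Q) : MonoidAlgebra k Q :=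
  ∑ᶠ c : Q ⧸ H, conjActF k Q (Quotient.out c) x

/-- The image `Tr_H^Q(k[Q]^H)`. -/
def trImageF (H : Subgroup Q) : Set (MonoidAlgebra k Q) :=
  trMapF k Q H '' fixedByF k Q H

/-- `Dq` is a defect group of the block of `e` in the group algebra `k[Q]`. -/
structure IsDefectGroupF (e : MonoidAlgebra k Q) (Dq : Subgroup Q) : Prop where
  defect : e ∈ trImageF k Q Dq
  minimal : ∀ D' : Subgroup Q, D' ≤ Dq → e ∈ trImageF k Q D' → D' = Dq

end FiniteDefect

section CyclicDefect

variable {k : Type} [Field k] {G : Type} [Group G] [TopologicalSpace G]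

variable (G) in
/-- A subgroup is procyclic if it possesses a dense cyclic (abstract) subgroup. -/
def IsProcyclic (D : Subgroup G) : Prop :=
  ∃ g : G, closure ((Subgroup.zpowers g : Subgroup G) : Set G) = (D : Set G)

variable (G) in
/-- `D` is isomorphic, as a topological group, to the `p`-adic integers `ℤ_p`. -/
def IsZpGroup (p : ℕ) [Fact p.Prime] (D : Subgroup G) : Prop :=
  ∃ φ : D ≃ₜ Multiplicative ℤ_[p], ∀ x y : D, φ (x * y) = φ x * φ y

variable (G) in
/-- `D` is a cyclic pro-`p` group: either a finite cyclic `p`-group or `ℤ_p`. -/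
def IsCyclicProP (p : ℕ) [Fact p.Prime] (D : Subgroup G) : Prop :=
  (Finite D ∧ IsPGroup p D ∧ IsCyclic D) ∨ IsZpGroup G p D

end CyclicDefect

section Simples

variable {k : Type} [Field k] {G : Type} [Group G] [TopologicalSpace G]

variable (k G) in
/-- The projection `k⟦G⟧ → k[G/N]`. -/
def projN (N : OpenNormalSubgroup G) (x : CGA k G) :
    MonoidAlgebra k (G ⧸ N.toSubgroup) :=
  (x : ∀ N : OpenNormalSubgroup G, MonoidAlgebra k (G ⧸ N.toSubgroup)) N

variable (k G) in
/-- `N` acts trivially on every simple module of the block of `e`. -/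
def TrivOnSimples (e : CGA k G) (N : OpenNormalSubgroup G) : Prop :=
  ∀ (S : Type) [AddCommGroup S] [Module (CGA k G) S],
    IsSimpleModule (CGA k G) S → InBlock (CGA k G) (X := S) e → NTrivial k G N S

variable (k G) in
/-- Membership of `N` in the standard cofinal system `𝒩` for the block `B` of `e`
with defect group `D`: the coinvariant algebra `B_N` is a block of `k[G/N]` with
defect group `DN/N`, and `N` acts trivially on every simple `B`-module. -/
structure GoodN (e : CGA k G) (D : Subgroup G) (N : OpenNormalSubgroup G) : Prop where
  blockN : IsBlockIdem (MonoidAlgebra k (G ⧸ N.toSubgroup)) (projN k G N e)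
  defectN : IsDefectGroupF k (G ⧸ N.toSubgroup) (projN k G N e)
    (D.map (QuotientGroup.mk' N.toSubgroup))
  triv : TrivOnSimples k G e N

/-- A cofinal set of open normal subgroups. -/
def IsCofinal {G : Type} [Group G] [TopologicalSpace G]
    (𝒩 : Set (OpenNormalSubgroup G)) : Prop :=
  ∀ M : OpenNormalSubgroup G, ∃ N ∈ 𝒩, N ≤ M

variable (k G) in
/-- A pseudocompact module is pro-uniserial (w.r.t. the cofinal system `𝒩`) if all
its coinvariant quotients at members of `𝒩` are uniserial. -/
def ProUniserial (𝒩 : Set (OpenNormalSubgroup G)) (U : Type) [AddCommGroup U]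
    [Module (CGA k G) U] [TopologicalSpace U] : Prop :=
  ∀ N ∈ 𝒩, Uniserial (CGA k G) (coinv k G N U)

variable (k G) in
/-- `S` is a composition factor of the pseudocompact module `U`: it is a composition
factor of some finite coinvariant quotient `U_N`. -/
def IsCompFactorOf (U : Type) [AddCommGroup U] [Module (CGA k G) U]
    [TopologicalSpace U] (S : Type) [AddCommGroup S] [Module (CGA k G) S] : Prop :=
  ∃ (N : OpenNormalSubgroup G) (W W' : Submodule (CGA k G) (coinv k G N U)),
    W' ≤ W ∧ Nonempty (subQuot W W' ≃ₗ[CGA k G] S)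

variable (k G) in
/-- `S` is a composition factor of the finite-dimensional module `X`. -/
def IsCompFactorFin (X : Type) [AddCommGroup X] [Module (CGA k G) X]
    (S : Type) [AddCommGroup S] [Module (CGA k G) S] : Prop :=
  ∃ W W' : Submodule (CGA k G) X, W' ≤ W ∧ Nonempty (subQuot W W' ≃ₗ[CGA k G] S)

end Simples

section Projective

variable {k : Type} [Field k] {G : Type} [Group G] [TopologicalSpace G]

variable (k G) in
/-- A pseudocompact `k⟦G⟧`-module is (categorically) projective if every continuous
surjection onto it from a pseudocompact module splits. -/
def IsPCProjective (P : Type) [AddCommGroup P] [Module (CGA k G) P]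
    [TopologicalSpace P] : Prop :=
  ∀ (W : Type) [AddCommGroup W] [Module k W] [Module (CGA k G) W]
    [IsScalarTower k (CGA k G) W] [TopologicalSpace W],
    IsPseudocompactMod k (CGA k G) W →
    ∀ f : W →ₗ[CGA k G] P, Continuous f → Function.Surjective f →
      ∃ s : P →ₗ[CGA k G] W, Continuous s ∧ f.comp s = LinearMap.id

variable (k G) in
/-- `P` is a projective cover of the simple module `S` in the block of `e`:
a pseudocompact projective module of the block together with a surjection onto `S`
whose kernel is superfluous (contained in the radical). -/
structure IsProjCover (e : CGA k G) (P : Type) [AddCommGroup P] [Module k P]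
    [Module (CGA k G) P] [IsScalarTower k (CGA k G) P] [TopologicalSpace P]
    (S : Type) [AddCommGroup S] [Module (CGA k G) S] : Prop where
  pseudocompact : IsPseudocompactMod k (CGA k G) P
  inBlock : InBlock (CGA k G) (X := P) e
  projective : IsPCProjective k G P
  cover : ∃ π : P →ₗ[CGA k G] S, Function.Surjective π ∧
    LinearMap.ker π ≤ radical (CGA k G) P

end Projective




/-- The map between subquotients induced by `f`. -/
def subQuotMap {R X Y : Type} [Ring R] [AddCommGroup X] [AddCommGroup Y] [Module R X]
    [Module R Y] (W W' : Submodule R X) (V V' : Submodule R Y) (f : X →ₗ[R] Y) :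
    subQuot W W' →ₗ[R] subQuot V V' :=
  mapQ' (W'.comap W.subtype) (V'.comap V.subtype) (restrict' W V f)

/-- The conditions of Proposition 3.8 on a pair of pro-uniserial submodules `X`, `Y`
of an indecomposable projective `P`: `X ∩ Y = Soc(P)`, `X + Y = Rad(P)`, and
`Rad(P)/Soc(P) ≅ X/Soc(P) ⊕ Y/Soc(P)` with no common composition factors. -/
def ProUniserialPair (k : Type) [Field k] (G : Type) [Group G] [TopologicalSpace G]
    (𝒩 : Set (OpenNormalSubgroup G)) (P : Type) [AddCommGroup P]
    [Module (CGA k G) P] [TopologicalSpace P]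
    (X Y : Submodule (CGA k G) P) : Prop :=
  ProUniserial k G 𝒩 X ∧ ProUniserial k G 𝒩 Y ∧
  X ⊓ Y = socle (CGA k G) P ∧
  X ⊔ Y = radical (CGA k G) P ∧
  Nonempty ((subQuot (radical (CGA k G) P) (socle (CGA k G) P)) ≃ₗ[CGA k G]
    (subQuot X (socle (CGA k G) P) × subQuot Y (socle (CGA k G) P))) ∧
  ∀ (T : Type) [AddCommGroup T] [Module (CGA k G) T], IsSimpleModule (CGA k G) T →
    ¬ (IsCompFactorOf k G (subQuot X (socle (CGA k G) P)) T ∧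
       IsCompFactorOf k G (subQuot Y (socle (CGA k G) P)) T)

/-- `S : ι → Type` is a complete set of pairwise non-isomorphic representatives of
the simple modules of the block of `e`. -/
def IsSimpleReps (k : Type) [Field k] (G : Type) [Group G] [TopologicalSpace G]
    (e : CGA k G) {ι : Type} (S : ι → Type) [∀ i, AddCommGroup (S i)]
    [∀ i, Module (CGA k G) (S i)] : Prop :=
  (∀ i, IsSimpleModule (CGA k G) (S i) ∧ InBlock (CGA k G) (X := S i) e) ∧
  (∀ i j, i ≠ j → IsEmpty (S i ≃ₗ[CGA k G] S j)) ∧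
  (∀ (T : Type) [AddCommGroup T] [Module (CGA k G) T],
    IsSimpleModule (CGA k G) T → InBlock (CGA k G) (X := T) e →
      ∃ i, Nonempty (T ≃ₗ[CGA k G] S i))

section Brauer

/-- The size of the `ρ`-orbit of `i` (the number of edges at the corresponding vertex
of the Brauer tree). -/
def orbSize {ι : Type} (ρ : Equiv.Perm ι) (i : ι) : ℕ :=
  Function.minimalPeriod ρ i

/-- Data describing the exceptional vertex of a Brauer tree: `none` if there is no
exceptional vertex, and otherwise a flag recording whether it is a `ρ`-vertex or a
`σ`-vertex together with an edge adjacent to it. -/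
abbrev ExcVertex (ι : Type) : Type := Option (Bool × ι)

/-- The edge `i` is adjacent to the exceptional vertex, its `ρ`-endpoint being
exceptional. -/
def AdjExcRho {ι : Type} (ρ : Equiv.Perm ι) (exc : ExcVertex ι) (i : ι) : Prop :=
  ∃ j : ι, exc = some (true, j) ∧ ρ.SameCycle j i

/-- The edge `i` is adjacent to the exceptional vertex, its `σ`-endpoint being
exceptional. -/
def AdjExcSigma {ι : Type} (σ : Equiv.Perm ι) (exc : ExcVertex ι) (i : ι) : Prop :=
  ∃ j : ι, exc = some (false, j) ∧ σ.SameCycle j i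

/-- The edge `i` is adjacent to the exceptional vertex. -/
def AdjExc {ι : Type} (ρ σ : Equiv.Perm ι) (exc : ExcVertex ι) (i : ι) : Prop :=
  AdjExcRho ρ exc i ∨ AdjExcSigma σ exc i

end Brauer


section NilpotentOperators

variable {F V : Type} [Field F] [AddCommGroup V] [Module F V]

/-- Higman's criterion: a module over `F[t]/(t ^ j)` on which the kernel of `t ^ (j - 1)` is the
image of `t` has an endomorphism of trace one. -/
lemma exists_trace_eq_one (t : Module.End F V) (j : ℕ) (hj : 0 < j) (ht : t ^ j = 0)
    (hker : ∀ v, (t ^ (j - 1)) v = 0 → ∃ w, v = t w) :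
    ∃ l : Module.End F V, ∑ i ∈ Finset.range j, t ^ (j - 1 - i) * l * t ^ i = 1 := by
  obtain ⟨C, hC⟩ := Submodule.exists_isCompl (LinearMap.range t)
  have hinj : LinearMap.ker ((t ^ (j - 1)).comp C.subtype) = ⊥ := by
    rw [LinearMap.ker_eq_bot']
    rintro ⟨c, hc⟩ h
    obtain ⟨w, rfl⟩ := hker c h
    have : t w ∈ LinearMap.range t ⊓ C := ⟨⟨w, rfl⟩, hc⟩
    rw [hC.inf_eq_bot] at this
    exact Subtype.ext this
  obtain ⟨l₀, hl₀⟩ := LinearMap.exists_leftInverse_of_injective _ hinj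
  set l : Module.End F V := C.subtype.comp l₀ with hl
  have hlC : ∀ c ∈ C, l ((t ^ (j - 1)) c) = c := fun c hc => by
    have := LinearMap.congr_fun hl₀ ⟨c, hc⟩
    simpa [hl] using congrArg Subtype.val this
  set A : Module.End F V := ∑ i ∈ Finset.range j, t ^ (j - 1 - i) * l * t ^ i with hA
  obtain ⟨m, rfl⟩ : ∃ m, j = m + 1 := ⟨j - 1, by omega⟩
  have hcomm : t * A = A * t := by
    rw [hA, Finset.mul_sum, Finset.sum_mul, Finset.sum_range_succ', Finset.sum_range_succ]
    have h0 : t * (t ^ (m + 1 - 1 - 0) * l * t ^ 0) = 0 := by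
      rw [← mul_assoc, ← mul_assoc, ← pow_succ']
      simp [ht]
    have h1 : t ^ (m + 1 - 1 - m) * l * t ^ m * t = 0 := by
      rw [mul_assoc, ← pow_succ, ht, mul_zero]
    rw [h0, h1, add_zero, add_zero]
    refine Finset.sum_congr rfl fun i hi => ?_
    have hi := Finset.mem_range.1 hi
    rw [← mul_assoc, ← mul_assoc, ← pow_succ', mul_assoc _ (t ^ i) t, ← pow_succ]
    congr 3
    omega
  have hAC : ∀ c ∈ C, ∃ w, A c - c = t w := by
    intro c hc
    refine ⟨∑ i ∈ Finset.range m, (t ^ (m - 1 - i) * l * t ^ i) c, ?_⟩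
    rw [hA, Finset.sum_range_succ, LinearMap.add_apply]
    have : (t ^ (m + 1 - 1 - m) * l * t ^ m) c = c := by
      simpa using hlC c hc
    rw [this, add_sub_cancel_right, LinearMap.sum_apply, map_sum]
    refine Finset.sum_congr rfl fun i hi => ?_
    have hi := Finset.mem_range.1 hi
    rw [← Module.End.mul_apply, ← mul_assoc, ← mul_assoc, ← pow_succ']
    congr 4
    omega
  have hcA : ∀ v, A (t v) = t (A v) := fun v => (LinearMap.congr_fun hcomm v).symm
  have hAall : ∀ v, ∃ w, (A - 1) v = t w := by
    intro v
    have hv : v ∈ LinearMap.range t ⊔ C := by rw [hC.sup_eq_top]; trivial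
    obtain ⟨_, ⟨u, rfl⟩, c, hc, rfl⟩ := Submodule.mem_sup.1 hv
    obtain ⟨w, hw⟩ := hAC c hc
    refine ⟨A u - u + w, ?_⟩
    simp only [LinearMap.sub_apply, map_add, Module.End.one_apply, hcA, map_sub]
    rw [← hw]
  have hpow : ∀ n v, ∃ w, ((A - 1) ^ n) v = (t ^ n) w := by
    intro n
    induction n with
    | zero => intro v; exact ⟨v, rfl⟩
    | succ n ih =>
      intro v
      obtain ⟨w, hw⟩ := ih v
      obtain ⟨u, hu⟩ := hAall w
      refine ⟨u, ?_⟩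
      have hc : Commute (A - 1) (t ^ n) :=
        ((show Commute A t from hcomm.symm).sub_left (Commute.one_left t)).pow_right n
      rw [pow_succ', Module.End.mul_apply, hw, ← Module.End.mul_apply, hc.eq,
        Module.End.mul_apply, hu, ← Module.End.mul_apply, ← pow_succ]
  have hnil : (A - 1) ^ (m + 1) = 0 := by
    ext v
    obtain ⟨w, hw⟩ := hpow (m + 1) v
    rw [hw, ht]; rfl
  have hunit : IsUnit A := by
    have := IsNilpotent.isUnit_one_add (r := A - 1) ⟨_, hnil⟩
    simpa using this
  obtain ⟨B, hBA, hAB⟩ := isUnit_iff_exists.1 hunit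
  have hBt : Commute t B := by
    show t * B = B * t
    calc t * B = (B * A) * (t * B) := by rw [hAB, one_mul]
      _ = B * (A * t) * B := by simp only [mul_assoc]
      _ = B * (t * A) * B := by rw [hcomm]
      _ = B * t * (A * B) := by simp only [mul_assoc]
      _ = B * t := by rw [hBA, mul_one]
  refine ⟨B * l, ?_⟩
  calc _ = B * A := by
        rw [hA, Finset.mul_sum]
        refine Finset.sum_congr rfl fun i _ => ?_
        rw [← mul_assoc, (hBt.pow_left _).eq]
        simp only [mul_assoc]
    _ = 1 := hAB

lemma mem_range_pow_of_trace_eq_one (t l : Module.End F V) (j : ℕ)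
    (hl : ∑ i ∈ Finset.range j, t ^ (j - 1 - i) * l * t ^ i = 1) (i : ℕ) (hi : i ≤ j) (v : V)
    (hv : (t ^ i) v = 0) : ∃ w, v = (t ^ (j - i)) w := by
  refine ⟨∑ a ∈ Finset.range i, (t ^ (i - 1 - a) * l * t ^ a) v, ?_⟩
  have h := LinearMap.congr_fun hl v
  rw [Module.End.one_apply, LinearMap.sum_apply] at h
  nth_rewrite 1 [← h]
  rw [← Finset.sum_subset (Finset.range_mono hi)]
  · rw [map_sum]
    refine Finset.sum_congr rfl fun a ha => ?_
    have ha := Finset.mem_range.1 ha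
    rw [← Module.End.mul_apply, ← mul_assoc, ← mul_assoc, ← pow_add]
    congr 4
    omega
  · intro a _ ha
    have ha : i ≤ a := by simpa using ha
    obtain ⟨b, rfl⟩ := Nat.exists_eq_add_of_le' ha
    rw [Module.End.mul_apply, Module.End.mul_apply, pow_add, Module.End.mul_apply (t ^ b), hv, map_zero,
      map_zero, map_zero]

variable {W : Type} [AddCommGroup W] [Module F W]

/-- The trace of a linear map between two modules over `F[t]/(t ^ j)` commutes with `t`. -/
lemma trace_comm (t : Module.End F V) (t' : Module.End F W) (j : ℕ) (ht : t ^ j = 0)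
    (ht' : t' ^ j = 0) (s : V →ₗ[F] W) (v : V) :
    t' (∑ i ∈ Finset.range j, (t' ^ (j - 1 - i)) (s ((t ^ i) v))) =
      ∑ i ∈ Finset.range j, (t' ^ (j - 1 - i)) (s ((t ^ i) (t v))) := by
  rcases j with _ | m
  · simp
  rw [map_sum, Finset.sum_range_succ', Finset.sum_range_succ]
  have h0 : t' ((t' ^ (m + 1 - 1 - 0)) (s ((t ^ 0) v))) = 0 := by
    rw [← Module.End.mul_apply, ← pow_succ']
    simp [ht']
  have h1 : (t' ^ (m + 1 - 1 - m)) (s ((t ^ m) (t v))) = 0 := by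
    rw [← Module.End.mul_apply (t ^ m), ← pow_succ, ht]
    simp
  rw [h0, h1]
  congr 1
  refine Finset.sum_congr rfl fun i hi => ?_
  have hi := Finset.mem_range.1 hi
  rw [← Module.End.mul_apply, ← pow_succ', ← Module.End.mul_apply (t ^ i), ← pow_succ]
  congr 2
  omega

end NilpotentOperators

section Averaging

variable {F Γ : Type} [Field F] [Group Γ]

lemma single_smul_single_smul {V : Type} [AddCommGroup V] [Module (MonoidAlgebra F Γ) V]
    (a b : Γ) (v : V) :
    (MonoidAlgebra.single a (1 : F)) • (MonoidAlgebra.single b (1 : F)) • v =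
      (MonoidAlgebra.single (a * b) (1 : F)) • v := by
  rw [← mul_smul, MonoidAlgebra.single_mul_single, one_mul]

lemma single_one_smul {V : Type} [AddCommGroup V] [Module (MonoidAlgebra F Γ) V] (v : V) :
    (MonoidAlgebra.single (1 : Γ) (1 : F)) • v = v := by
  rw [← MonoidAlgebra.one_def, one_smul]

lemma single_commute_of_mem_fixedByF {D : Subgroup Γ} {x : MonoidAlgebra F Γ}
    (hx : x ∈ fixedByF F Γ D) {h : Γ} (hh : h ∈ D) :
    MonoidAlgebra.single h (1 : F) * x = x * MonoidAlgebra.single h (1 : F) := by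
  have := hx h hh
  rw [conjActF] at this
  nth_rewrite 2 [← this]
  rw [mul_assoc _ (MonoidAlgebra.single h⁻¹ (1 : F)), MonoidAlgebra.single_mul_single]
  simp [← MonoidAlgebra.one_def]

variable {V W : Type} [AddCommGroup V] [Module F V] [Module (MonoidAlgebra F Γ) V]
  [IsScalarTower F (MonoidAlgebra F Γ) V] [AddCommGroup W] [Module F W]
  [Module (MonoidAlgebra F Γ) W] [IsScalarTower F (MonoidAlgebra F Γ) W]

/-- The `g`-th term of the relative trace of the linear map `s`, twisted by `x`. -/
def traceTerm (x : MonoidAlgebra F Γ) (s : V →ₗ[F] W) (g : Γ) : V →ₗ[F] W :=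
  (Algebra.lsmul F F W (MonoidAlgebra.single g (1 : F) * x)).comp
    (s.comp (Algebra.lsmul F F V (MonoidAlgebra.single g⁻¹ (1 : F))))

lemma traceTerm_apply (x : MonoidAlgebra F Γ) (s : V →ₗ[F] W) (g : Γ) (v : V) :
    traceTerm x s g v = (MonoidAlgebra.single g (1 : F) * x) •
      s (MonoidAlgebra.single g⁻¹ (1 : F) • v) := rfl

lemma traceTerm_mul_right {D : Subgroup Γ} {x : MonoidAlgebra F Γ}
    (hx : x ∈ fixedByF F Γ D) {s : V →ₗ[F] W}
    (hs : ∀ h ∈ D, ∀ v, s (MonoidAlgebra.single h (1 : F) • v) =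
      MonoidAlgebra.single h (1 : F) • s v) (g : Γ) {h : Γ} (hh : h ∈ D) :
    traceTerm x s (g * h) = traceTerm x s g := by
  ext v
  rw [traceTerm_apply, traceTerm_apply, mul_inv_rev, ← single_smul_single_smul, hs _ (inv_mem hh),
    ← mul_smul]
  congr 1
  rw [mul_assoc, ← single_commute_of_mem_fixedByF hx (inv_mem hh), ← mul_assoc,
    MonoidAlgebra.single_mul_single]
  simp

lemma traceTerm_eq_of_mk_eq {D : Subgroup Γ} {x : MonoidAlgebra F Γ}
    (hx : x ∈ fixedByF F Γ D) {s : V →ₗ[F] W}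
    (hs : ∀ h ∈ D, ∀ v, s (MonoidAlgebra.single h (1 : F) • v) =
      MonoidAlgebra.single h (1 : F) • s v) {g g' : Γ} (h : (g : Γ ⧸ D) = g') :
    traceTerm x s g = traceTerm x s g' := by
  rw [← traceTerm_mul_right hx hs g (QuotientGroup.eq.1 h)]
  simp

variable [Finite Γ]

/-- The relative trace of a linear map commuting with `D` is linear over the group algebra. -/
lemma exists_relTrace {D : Subgroup Γ} {x : MonoidAlgebra F Γ}
    (hx : x ∈ fixedByF F Γ D) {s : V →ₗ[F] W}
    (hs : ∀ h ∈ D, ∀ v, s (MonoidAlgebra.single h (1 : F) • v) =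
      MonoidAlgebra.single h (1 : F) • s v) :
    ∃ s' : V →ₗ[MonoidAlgebra F Γ] W, ∀ v,
      s' v = ∑ᶠ c : Γ ⧸ D, traceTerm x s (Quotient.out c) v := by
  have := Fintype.ofFinite (Γ ⧸ D)
  simp only [finsum_eq_sum_of_fintype]
  refine ⟨MonoidAlgebra.equivariantOfLinearOfComm
    (∑ c : Γ ⧸ D, traceTerm x s (Quotient.out c)) fun g v => ?_, fun v => ?_⟩
  · rw [LinearMap.sum_apply, LinearMap.sum_apply, Finset.smul_sum,
      ← Equiv.sum_comp (MulAction.toPerm g : Equiv.Perm (Γ ⧸ D))]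
    refine Finset.sum_congr rfl fun c _ => ?_
    have : traceTerm x s (Quotient.out ((MulAction.toPerm g : Equiv.Perm (Γ ⧸ D)) c)) =
        traceTerm x s (g * Quotient.out c) := by
      apply traceTerm_eq_of_mk_eq hx hs
      rw [QuotientGroup.out_eq']
      change g • c = _
      nth_rewrite 1 [← QuotientGroup.out_eq' c]
      rfl
    rw [this, traceTerm_apply, traceTerm_apply, single_smul_single_smul, ← mul_smul, ← mul_assoc,
      MonoidAlgebra.single_mul_single]
    simp
  · simp [LinearMap.sum_apply]

lemma trMapF_smul {D : Subgroup Γ} (x : MonoidAlgebra F Γ) (v : V) :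
    trMapF F Γ D x • v = ∑ᶠ c : Γ ⧸ D, traceTerm x (LinearMap.id : V →ₗ[F] V)
      (Quotient.out c) v := by
  have := Fintype.ofFinite (Γ ⧸ D)
  rw [trMapF, finsum_eq_sum_of_fintype, finsum_eq_sum_of_fintype, Finset.sum_smul]
  refine Finset.sum_congr rfl fun c _ => ?_
  rw [traceTerm_apply, conjActF, mul_smul]
  rfl

end Averaging

section Cyclic

variable {F Γ : Type} [Field F] [Group Γ]

variable (F) in
/-- The element `d - 1` of the group algebra. -/
def augElt (d : Γ) : MonoidAlgebra F Γ := MonoidAlgebra.single d 1 - 1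

lemma augElt_smul {V : Type} [AddCommGroup V] [Module (MonoidAlgebra F Γ) V] (d : Γ) (v : V) :
    augElt F d • v = MonoidAlgebra.single d (1 : F) • v - v := by
  rw [augElt, sub_smul, one_smul]

lemma augElt_pow (p : ℕ) [Fact p.Prime] [CharP F p] (d : Γ) (n : ℕ) :
    augElt F d ^ p ^ n = augElt F (d ^ p ^ n) := by
  have : CharP (MonoidAlgebra F Γ) p := charP_of_injective_algebraMap
    (algebraMap F (MonoidAlgebra F Γ)).injective p
  rw [augElt, augElt, sub_pow_char_pow_of_commute _ _ (Commute.one_right _), one_pow,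
    MonoidAlgebra.single_pow, one_pow]

variable {V W : Type} [AddCommGroup V] [Module F V] [Module (MonoidAlgebra F Γ) V]
  [IsScalarTower F (MonoidAlgebra F Γ) V] [AddCommGroup W] [Module F W]
  [Module (MonoidAlgebra F Γ) W] [IsScalarTower F (MonoidAlgebra F Γ) W]

variable (F V) in
/-- The action of `d - 1` on a module. -/
abbrev augEnd (d : Γ) : Module.End F V := Algebra.lsmul F F V (augElt F d)

lemma augEnd_pow_apply (d : Γ) (n : ℕ) (v : V) :
    (augEnd F V d ^ n) v = augElt F d ^ n • v := by
  rw [← map_pow]; rfl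

variable [Finite Γ]

lemma commute_zpowers_of_commute_augElt {d : Γ} {s : V →ₗ[F] W}
    (hs : ∀ v, s (augElt F d • v) = augElt F d • s v) :
    ∀ h ∈ Subgroup.zpowers d, ∀ v, s (MonoidAlgebra.single h (1 : F) • v) =
      MonoidAlgebra.single h (1 : F) • s v := by
  have hd : ∀ v, s (MonoidAlgebra.single d (1 : F) • v) = MonoidAlgebra.single d (1 : F) • s v := by
    intro v
    have := hs v
    rw [augElt_smul, augElt_smul, map_sub] at this
    exact sub_left_injective this
  intro h hh
  obtain ⟨n, rfl⟩ := (Submonoid.mem_powers_iff _ _).1 ((mem_powers_iff_mem_zpowers).2 hh)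
  induction n with
  | zero => intro v; rw [pow_zero, single_one_smul, single_one_smul]
  | succ n ih =>
    intro v
    rw [pow_succ, ← single_smul_single_smul, ih (Subgroup.npow_mem_zpowers d n), hd,
      single_smul_single_smul]

/-- Relative projectivity: a linear map to a module on which `(d - 1) ^ j` vanishes lifts along
surjections. -/
lemma exists_lift {d : Γ} {x : MonoidAlgebra F Γ}
    (hx : x ∈ fixedByF F Γ (Subgroup.zpowers d))
    (hV : ∀ v : V, trMapF F Γ (Subgroup.zpowers d) x • v = v)
    {j : ℕ} {l : Module.End F V}
    (hl : ∑ i ∈ Finset.range j, augEnd F V d ^ (j - 1 - i) * l * augEnd F V d ^ i = 1)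
    (hjV : augEnd F V d ^ j = 0) (hjW : augEnd F W d ^ j = 0)
    {Z : Type} [AddCommGroup Z] [Module (MonoidAlgebra F Γ) Z]
    (f : W →ₗ[MonoidAlgebra F Γ] Z) (hf : Function.Surjective f)
    (u : V →ₗ[MonoidAlgebra F Γ] Z) :
    ∃ g : V →ₗ[MonoidAlgebra F Γ] W, f.comp g = u := by
  let : Module F Z := Module.compHom Z (algebraMap F (MonoidAlgebra F Γ))
  have : IsScalarTower F (MonoidAlgebra F Γ) Z := ⟨fun a b z => by
    rw [Algebra.smul_def, mul_smul]; rfl⟩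
  obtain ⟨s, hs⟩ := Module.projective_lifting_property (f.restrictScalars F)
    (u.restrictScalars F) hf
  have hs : ∀ v, f (s v) = u v := fun v => LinearMap.congr_fun hs v
  let s₁ : V →ₗ[F] W :=
    ∑ i ∈ Finset.range j, (augEnd F W d ^ (j - 1 - i)).comp ((s ∘ₗ l).comp (augEnd F V d ^ i))
  have hs₁ : ∀ v, s₁ v = ∑ i ∈ Finset.range j,
      (augEnd F W d ^ (j - 1 - i)) ((s ∘ₗ l) ((augEnd F V d ^ i) v)) := fun v => by
    simp only [s₁, LinearMap.sum_apply]; rfl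
  have hcomm : ∀ v, s₁ (augElt F d • v) = augElt F d • s₁ v := fun v => by
    rw [hs₁, hs₁]
    exact (trace_comm _ _ j hjV hjW (s ∘ₗ l) v).symm
  have hfs₁ : ∀ v, f (s₁ v) = u v := fun v => by
    rw [hs₁, map_sum]
    conv_rhs => rw [← Module.End.one_apply (R := F) v, ← hl, LinearMap.sum_apply, map_sum]
    refine Finset.sum_congr rfl fun i _ => ?_
    rw [augEnd_pow_apply, map_smul, LinearMap.comp_apply, hs, ← map_smul, Module.End.mul_apply,
      Module.End.mul_apply, augEnd_pow_apply d (j - 1 - i)]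
  obtain ⟨g, hg⟩ := exists_relTrace hx (commute_zpowers_of_commute_augElt hcomm)
  refine ⟨g, ?_⟩
  ext v
  have := Fintype.ofFinite (Γ ⧸ Subgroup.zpowers d)
  rw [LinearMap.comp_apply, hg]
  conv_rhs => rw [← hV v, trMapF_smul]
  rw [finsum_eq_sum_of_fintype, finsum_eq_sum_of_fintype, map_sum, map_sum]
  refine Finset.sum_congr rfl fun c _ => ?_
  rw [traceTerm_apply, map_smul, hfs₁, ← map_smul, traceTerm_apply]
  rfl

/-- Relative injectivity: a linear map from a module on which `(d - 1) ^ j` vanishes extends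
along injections. -/
lemma exists_extension {d : Γ} {x : MonoidAlgebra F Γ}
    (hx : x ∈ fixedByF F Γ (Subgroup.zpowers d))
    (hV : ∀ v : V, trMapF F Γ (Subgroup.zpowers d) x • v = v)
    {j : ℕ} {l : Module.End F V}
    (hl : ∑ i ∈ Finset.range j, augEnd F V d ^ (j - 1 - i) * l * augEnd F V d ^ i = 1)
    (hjV : augEnd F V d ^ j = 0) (hjW : augEnd F W d ^ j = 0)
    {Z : Type} [AddCommGroup Z] [Module (MonoidAlgebra F Γ) Z]
    (f : Z →ₗ[MonoidAlgebra F Γ] W) (hf : Function.Injective f)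
    (u : Z →ₗ[MonoidAlgebra F Γ] V) :
    ∃ g : W →ₗ[MonoidAlgebra F Γ] V, g.comp f = u := by
  let : Module F Z := Module.compHom Z (algebraMap F (MonoidAlgebra F Γ))
  have : IsScalarTower F (MonoidAlgebra F Γ) Z := ⟨fun a b z => by
    rw [Algebra.smul_def, mul_smul]; rfl⟩
  obtain ⟨r, hr⟩ := LinearMap.exists_leftInverse_of_injective (f.restrictScalars F)
    (LinearMap.ker_eq_bot.2 hf)
  let s : W →ₗ[F] V := (u.restrictScalars F).comp r
  have hs : ∀ z, s (f z) = u z := fun z => congrArg u (LinearMap.congr_fun hr z)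
  let s₁ : W →ₗ[F] V :=
    ∑ i ∈ Finset.range j, (augEnd F V d ^ (j - 1 - i)).comp ((l ∘ₗ s).comp (augEnd F W d ^ i))
  have hs₁ : ∀ v, s₁ v = ∑ i ∈ Finset.range j,
      (augEnd F V d ^ (j - 1 - i)) ((l ∘ₗ s) ((augEnd F W d ^ i) v)) := fun v => by
    simp only [s₁, LinearMap.sum_apply]; rfl
  have hcomm : ∀ v, s₁ (augElt F d • v) = augElt F d • s₁ v := fun v => by
    rw [hs₁, hs₁]
    exact (trace_comm _ _ j hjW hjV (l ∘ₗ s) v).symm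
  have hfs₁ : ∀ z, s₁ (f z) = u z := fun z => by
    rw [hs₁]
    conv_rhs => rw [← Module.End.one_apply (R := F) (u z), ← hl, LinearMap.sum_apply]
    refine Finset.sum_congr rfl fun i _ => ?_
    rw [augEnd_pow_apply d i (f z), ← map_smul, LinearMap.comp_apply, hs, map_smul,
      Module.End.mul_apply, Module.End.mul_apply, augEnd_pow_apply d i (u z)]
  obtain ⟨g, hg⟩ := exists_relTrace hx (commute_zpowers_of_commute_augElt hcomm)
  refine ⟨g, ?_⟩
  ext z
  have := Fintype.ofFinite (Γ ⧸ Subgroup.zpowers d)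
  rw [LinearMap.comp_apply, hg]
  conv_rhs => rw [← hV (u z), trMapF_smul]
  rw [finsum_eq_sum_of_fintype, finsum_eq_sum_of_fintype]
  refine Finset.sum_congr rfl fun c _ => ?_
  rw [traceTerm_apply, ← map_smul f, hfs₁, map_smul, traceTerm_apply]
  rfl

lemma augElt_pow_card_sub_one (p : ℕ) [Fact p.Prime] [CharP F p] (d : Γ) (n : ℕ) :
    augElt F d ^ (p ^ n - 1) = ∑ i ∈ Finset.range (p ^ n), MonoidAlgebra.single (d ^ i) (1 : F) := by
  have hpos : 0 < p ^ n := pow_pos (Fact.out : p.Prime).pos n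
  have key : ((Polynomial.X : Polynomial F) - 1) ^ (p ^ n - 1) =
      ∑ i ∈ Finset.range (p ^ n), (Polynomial.X : Polynomial F) ^ i := by
    have h0 : (Polynomial.X : Polynomial F) - 1 ≠ 0 := by
      rw [← Polynomial.C_1]; exact Polynomial.X_sub_C_ne_zero 1
    apply mul_right_cancel₀ h0
    rw [geom_sum_mul, ← pow_succ, Nat.sub_add_cancel hpos, sub_pow_char_pow, one_pow]
  have := congrArg (Polynomial.aeval (MonoidAlgebra.single d (1 : F))) key
  simpa [augElt, MonoidAlgebra.single_pow] using this

/-- The projection of the group algebra onto the span of coset representatives of a cyclic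
subgroup has trace one. -/
lemma exists_sum_conj_eq_self (d : Γ) :
    ∃ m : Module.End F (MonoidAlgebra F Γ), ∀ v, ∑ i ∈ Finset.range (orderOf d),
      MonoidAlgebra.single (d ^ i) (1 : F) * m (MonoidAlgebra.single (d ^ i)⁻¹ (1 : F) * v) = v := by
  let T : Set Γ := {g | Quotient.out ((g⁻¹ : Γ) : Γ ⧸ Subgroup.zpowers d) = g⁻¹}
  let m : Module.End F (MonoidAlgebra F Γ) := (MonoidAlgebra.basis Γ F).constr F
    fun g => if g ∈ T then MonoidAlgebra.single g 1 else 0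
  have hm : ∀ g, m (MonoidAlgebra.single g 1) = if g ∈ T then MonoidAlgebra.single g 1 else 0 :=
    fun g => by
      have h := Module.Basis.constr_basis (MonoidAlgebra.basis Γ F) F
        (fun g => if g ∈ T then (MonoidAlgebra.single g 1 : MonoidAlgebra F Γ) else 0) g
      rw [MonoidAlgebra.basis_apply] at h
      exact h
  let A : Module.End F (MonoidAlgebra F Γ) := ∑ i ∈ Finset.range (orderOf d),
    (LinearMap.mulLeft F (MonoidAlgebra.single (d ^ i) (1 : F))).comp
      (m.comp (LinearMap.mulLeft F (MonoidAlgebra.single (d ^ i)⁻¹ (1 : F))))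
  suffices h : A = LinearMap.id from ⟨m, fun v => by
    simpa [A, LinearMap.sum_apply] using LinearMap.congr_fun h v⟩
  refine (MonoidAlgebra.basis Γ F).ext fun g => ?_
  obtain ⟨i, hi, hgi⟩ : ∃ i < orderOf d, g⁻¹ * d ^ i =
      Quotient.out ((g⁻¹ : Γ) : Γ ⧸ Subgroup.zpowers d) := by
    have h := QuotientGroup.eq.1 (QuotientGroup.out_eq' ((g⁻¹ : Γ) : Γ ⧸ Subgroup.zpowers d)).symm
    rw [mem_zpowers_iff_mem_range_orderOf] at h
    obtain ⟨i, hi, h⟩ := Finset.mem_image.1 h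
    exact ⟨i, Finset.mem_range.1 hi, by rw [h]; group⟩
  have hmk : ∀ a, (((g⁻¹ * d ^ a : Γ)) : Γ ⧸ Subgroup.zpowers d) = (g⁻¹ : Γ) := fun a => by
    rw [QuotientGroup.eq]
    simp
  have hT : ∀ a < orderOf d, (d ^ a)⁻¹ * g ∈ T ↔ a = i := by
    intro a ha
    change Quotient.out ((((d ^ a)⁻¹ * g)⁻¹ : Γ) : Γ ⧸ Subgroup.zpowers d) = ((d ^ a)⁻¹ * g)⁻¹ ↔ _
    rw [mul_inv_rev, inv_inv, hmk, ← hgi]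
    constructor
    · intro h
      exact (pow_injOn_Iio_orderOf (x := d) (Set.mem_Iio.2 hi) (Set.mem_Iio.2 ha)
        (mul_left_cancel h)).symm
    · rintro rfl; rfl
  simp only [A, LinearMap.sum_apply, LinearMap.comp_apply, LinearMap.mulLeft_apply,
    MonoidAlgebra.basis_apply, MonoidAlgebra.single_mul_single, one_mul, hm, LinearMap.id_apply]
  rw [Finset.sum_eq_single i]
  · rw [if_pos ((hT i hi).2 rfl), MonoidAlgebra.single_mul_single]
    simp
  · intro a ha hai
    rw [if_neg (fun h => hai ((hT a (Finset.mem_range.1 ha)).1 h)), mul_zero]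
  · intro h
    exact absurd (Finset.mem_range.2 hi) h

/-- Over a cyclic `p`-group, the group algebra of an overgroup is free: the kernel of
`(d - 1) ^ i` is the image of the complementary power. -/
lemma mem_range_augElt_pow_of_smul_eq_zero (p : ℕ) [Fact p.Prime] [CharP F p] {d : Γ} {n : ℕ}
    (hd : orderOf d = p ^ n) {V : Type} [AddCommGroup V] [Module (MonoidAlgebra F Γ) V]
    [Module.Finite (MonoidAlgebra F Γ) V] [Module.Projective (MonoidAlgebra F Γ) V]
    {i : ℕ} (hi : i ≤ p ^ n) {v : V} (hv : augElt F d ^ i • v = 0) :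
    ∃ w, v = augElt F d ^ (p ^ n - i) • w := by
  have hR : ∀ r : MonoidAlgebra F Γ, augElt F d ^ i * r = 0 →
      ∃ w, r = augElt F d ^ (p ^ n - i) * w := by
    intro r hr
    have h1 : augEnd F (MonoidAlgebra F Γ) d ^ p ^ n = 0 := by
      refine LinearMap.ext fun r => ?_
      rw [augEnd_pow_apply, augElt_pow, ← hd, pow_orderOf_eq_one, augElt, ← MonoidAlgebra.one_def,
        sub_self, zero_smul]
      rfl
    obtain ⟨m, hm⟩ := exists_sum_conj_eq_self (F := F) d
    obtain ⟨l, hl⟩ := exists_trace_eq_one _ _ (pow_pos (Fact.out : p.Prime).pos n) h1 (by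
      intro v hv
      rw [augEnd_pow_apply, augElt_pow_card_sub_one, smul_eq_mul, Finset.sum_mul] at hv
      have hinv : ∑ i ∈ Finset.range (p ^ n), MonoidAlgebra.single (d ^ i)⁻¹ (1 : F) * v = 0 := by
        have h := congrArg (fun r => MonoidAlgebra.single (d ^ (p ^ n - 1))⁻¹ (1 : F) * r) hv
        rw [← Finset.sum_range_reflect] at h
        simp only [Finset.mul_sum, mul_zero, ← mul_assoc, MonoidAlgebra.single_mul_single,
          one_mul] at h
        rw [← h]
        refine Finset.sum_congr rfl fun i hi => ?_
        have hi' : p ^ n - 1 = i + (p ^ n - 1 - i) := by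
          have := Finset.mem_range.1 hi
          omega
        congr 2
        conv_rhs => rw [hi', add_comm, pow_add]
        simp
      have hone : ∀ (i : ℕ) (a : MonoidAlgebra F Γ), ∃ w,
          MonoidAlgebra.single (d ^ i) (1 : F) * a - a = augElt F d * w := by
        intro i
        induction i with
        | zero => exact fun a => ⟨0, by
            rw [pow_zero, ← MonoidAlgebra.one_def, one_mul, sub_self, mul_zero]⟩
        | succ i ih =>
          intro a
          obtain ⟨w, hw⟩ := ih a
          refine ⟨MonoidAlgebra.single (d ^ i) 1 * a + w, ?_⟩
          rw [mul_add, ← hw, augElt, sub_mul, one_mul, ← mul_assoc,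
            MonoidAlgebra.single_mul_single, one_mul, ← pow_succ']
          abel
      choose w hw using hone
      refine ⟨∑ i ∈ Finset.range (p ^ n), w i (m (MonoidAlgebra.single (d ^ i)⁻¹ (1 : F) * v)), ?_⟩
      change _ = augElt F d * _
      rw [Finset.mul_sum]
      simp only [← hw]
      rw [Finset.sum_sub_distrib, ← map_sum, hinv, map_zero, sub_zero, ← hd, hm])
    obtain ⟨w, hw⟩ := mem_range_pow_of_trace_eq_one _ l _ hl i hi r (by
      rw [augEnd_pow_apply]; exact hr)
    exact ⟨w, by rw [hw, augEnd_pow_apply]; rfl⟩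
  obtain ⟨a, f, g, -, -, hfg⟩ := Module.Finite.exists_comp_eq_id_of_projective (MonoidAlgebra F Γ) V
  have hg : ∀ b, augElt F d ^ i * g v b = 0 := fun b => by
    have := congrFun (congrArg g hv) b
    rw [map_smul, map_zero] at this
    exact this
  choose w hw using fun b => hR _ (hg b)
  refine ⟨f w, ?_⟩
  rw [← map_smul]
  have : augElt F d ^ (p ^ n - i) • w = g v := by
    ext1 b
    exact (hw b).symm
  rw [this]
  exact (LinearMap.congr_fun hfg v).symm

end Cyclic

section Local

variable (R : Type) [Ring R] (X : Type) [AddCommGroup X] [Module R X]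

/-- A module is local if it has a greatest proper submodule. -/
def IsLocalMod : Prop :=
  ∃ U : Submodule R X, U ≠ ⊤ ∧ ∀ W : Submodule R X, W ≠ ⊤ → W ≤ U

variable {R X} {Y : Type} [AddCommGroup Y] [Module R Y]

lemma IsLocalMod.eq_top_or_eq_top (h : IsLocalMod R X) {A B : Submodule R X} (hAB : A ⊔ B = ⊤) :
    A = ⊤ ∨ B = ⊤ := by
  obtain ⟨U, hU, hW⟩ := h
  by_contra! hc
  exact hU (top_unique (hAB ▸ sup_le (hW _ hc.1) (hW _ hc.2)))

lemma IsLocalMod.of_surjective [Nontrivial Y] (h : IsLocalMod R X) (f : X →ₗ[R] Y)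
    (hf : Function.Surjective f) : IsLocalMod R Y := by
  obtain ⟨U, hU, hW⟩ := h
  have hle : ∀ W : Submodule R Y, W ≠ ⊤ → W.comap f ≤ U := fun W hWt => hW _ fun hc => hWt <|
    top_unique fun y _ => by
      obtain ⟨x, rfl⟩ := hf y
      exact (hc ▸ Submodule.mem_top : x ∈ W.comap f)
  refine ⟨U.map f, fun hc => hU ?_, fun W hWt y hy => ?_⟩
  · have hk := hle ⊥ bot_ne_top
    refine top_unique fun x _ => ?_
    obtain ⟨u, hu, hux⟩ := (hc ▸ Submodule.mem_top : f x ∈ U.map f)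
    have : x - u ∈ U := hk (by simp [hux])
    simpa using add_mem this hu
  · obtain ⟨x, rfl⟩ := hf y
    exact ⟨x, hle W hWt hy, rfl⟩

lemma isLocalMod_of_lifts [IsNoetherian R X] [IsArtinian R X] [Nontrivial X]
    (hlift : ∀ W U : Submodule R X, W ⊔ U = ⊤ →
      ∃ g : X →ₗ[R] X, (∀ x, g x ∈ W) ∧ ∀ x, g x - x ∈ U)
    (hind : ∀ A B : Submodule R X, IsCompl A B → A = ⊥ ∨ B = ⊥) : IsLocalMod R X := by
  obtain ⟨U, hU, -⟩ := (eq_top_or_exists_le_coatom (⊥ : Submodule R X)).resolve_left bot_ne_top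
  refine ⟨U, hU.1, fun W hW => ?_⟩
  by_contra hWU
  have hsup : W ⊔ U = ⊤ := by
    rw [sup_comm]
    exact hU.2 _ (left_lt_sup.2 hWU)
  obtain ⟨g, hgW, hgU⟩ := hlift W U hsup
  obtain ⟨n, hn⟩ := Filter.eventually_atTop.1 g.eventually_isCompl_ker_pow_range_pow
  have hgn : ∀ n x, (g ^ n) x - x ∈ U := fun n x => by
    induction n with
    | zero => simp
    | succ n ih =>
      have := add_mem (hgU ((g ^ n) x)) ih
      rw [pow_succ', Module.End.mul_apply]
      simpa using this
  have hn1 := hn (n + 1) (Nat.le_succ n)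
  rcases hind _ _ hn1 with h | h
  · have ht := hn1.sup_eq_top
    rw [h, bot_sup_eq] at ht
    refine hW (top_unique fun x _ => ?_)
    obtain ⟨y, rfl⟩ := (ht ▸ Submodule.mem_top : x ∈ LinearMap.range (g ^ (n + 1)))
    rw [pow_succ', Module.End.mul_apply]
    exact hgW _
  · refine hU.1 (top_unique fun x _ => ?_)
    have := hgn (n + 1) x
    rw [LinearMap.range_eq_bot.1 h] at this
    simpa using this

lemma Uniserial.of_greatest {U : Submodule R X} (hU : ∀ W : Submodule R X, W ≠ ⊤ → W ≤ U)
    (h : Uniserial R U) : Uniserial R X := by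
  intro W W'
  by_cases hW : W = ⊤
  · exact Or.inr (hW ▸ le_top)
  by_cases hW' : W' = ⊤
  · exact Or.inl (hW' ▸ le_top)
  have key : ∀ A B : Submodule R X, A ≤ U → A.comap U.subtype ≤ B.comap U.subtype → A ≤ B :=
    fun A B hA hAB a ha => hAB (x := ⟨a, hA ha⟩) ha
  exact (h (W.comap U.subtype) (W'.comap U.subtype)).imp (key _ _ (hU W hW)) (key _ _ (hU W' hW'))

/-- A local module over an artinian ring is an image of a local projective left ideal. -/
lemma IsLocalMod.exists_projective_cover [IsArtinianRing R] {U : Submodule R X} (hU : U ≠ ⊤)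
    (hW : ∀ W : Submodule R X, W ≠ ⊤ → W ≤ U) :
    ∃ (L : Submodule R R) (f : L →ₗ[R] X), Module.Projective R L ∧ Function.Surjective f ∧
      ∀ W : Submodule R L, W ≠ ⊤ → W ≤ U.comap f := by
  let Good : Submodule R R → Prop := fun L =>
    ∃ f : L →ₗ[R] X, Module.Projective R L ∧ Function.Surjective f
  have hne : ∃ L, Good L := by
    obtain ⟨x, -, hx⟩ := SetLike.exists_of_lt (lt_top_iff_ne_top.2 hU)
    refine ⟨⊤, (LinearMap.toSpanSingleton R X x).comp (⊤ : Submodule R R).subtype,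
      Module.Projective.of_equiv Submodule.topEquiv.symm, ?_⟩
    have : R ∙ x = ⊤ := by
      by_contra hc
      exact hx (hW _ hc (Submodule.mem_span_singleton_self x))
    intro y
    obtain ⟨r, rfl⟩ := Submodule.mem_span_singleton.1 (this ▸ Submodule.mem_top : y ∈ R ∙ x)
    exact ⟨⟨r, trivial⟩, rfl⟩
  obtain ⟨L, ⟨f, hL, hf⟩, hmin⟩ := WellFounded.has_min
    (wellFounded_lt : WellFounded ((· < ·) : Submodule R R → Submodule R R → Prop)) {L | Good L} hne
  refine ⟨L, f, hL, hf, fun W hWt => ?_⟩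
  by_contra hWU
  have hWf : W.map f = ⊤ := by
    by_contra hc
    exact hWU (Submodule.map_le_iff_le_comap.1 (hW _ hc))
  obtain ⟨g, hg⟩ := Module.projective_lifting_property (f.comp W.subtype) f (fun y => by
    obtain ⟨w, hw, rfl⟩ := (hWf ▸ Submodule.mem_top : y ∈ W.map f)
    exact ⟨⟨w, hw⟩, rfl⟩)
  let h : L →ₗ[R] L := W.subtype.comp g
  have hfh : ∀ n x, f ((h ^ n) x) = f x := fun n x => by
    induction n with
    | zero => rfl
    | succ n ih =>
      rw [pow_succ', Module.End.mul_apply, ← ih]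
      exact LinearMap.congr_fun hg _
  obtain ⟨n, hn⟩ := Filter.eventually_atTop.1 h.eventually_isCompl_ker_pow_range_pow
  have hn1 := hn (n + 1) (Nat.le_succ n)
  set T := LinearMap.range (h ^ (n + 1))
  have hTW : T ≤ W := by
    rintro _ ⟨y, rfl⟩
    rw [pow_succ', Module.End.mul_apply]
    exact (g _).2
  have hTp : Module.Projective R T := Module.Projective.of_split T.subtype
    (Submodule.projectionOnto _ _ hn1.symm)
    (LinearMap.ext fun t => Submodule.projectionOnto_apply_left hn1.symm t)
  have hTT : T ≃ₗ[R] T.map L.subtype := Submodule.equivMapOfInjective _ L.subtype_injective T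
  refine hmin (T.map L.subtype) ⟨(f.comp T.subtype).comp hTT.symm.toLinearMap,
    Module.Projective.of_equiv hTT, ?_⟩ ?_
  · intro y
    obtain ⟨x, rfl⟩ := hf y
    refine ⟨hTT ⟨(h ^ (n + 1)) x, ⟨x, rfl⟩⟩, ?_⟩
    simp [hfh]
  · refine lt_of_le_of_ne (Submodule.map_subtype_le _ _) fun hc => hWt (top_unique fun x _ => ?_)
    obtain ⟨y, hy, hyx⟩ := (hc.symm ▸ x.2 : (x : R) ∈ T.map L.subtype)
    exact hTW (Subtype.ext hyx ▸ hy)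

end Local

section CyclicDefectFinite

variable {F Γ : Type} [Field F] [Group Γ]

/-- The data on a finite group algebra needed to show that local modules are uniserial: `e` is a
central idempotent, a relative trace from the cyclic `p`-group generated by `d`, and a proper
non-trivial power of `d - 1` is normal and kills the simple modules of `e`. -/
structure CyclicTraceData (p m n : ℕ) (e x : MonoidAlgebra F Γ) (d : Γ) : Prop where
  idem : e * e = e
  central : ∀ r, r * e = e * r
  fixed : x ∈ fixedByF F Γ (Subgroup.zpowers d)
  trace : trMapF F Γ (Subgroup.zpowers d) x = e
  order : orderOf d = p ^ m
  lt : n < m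
  left : ∀ r, ∃ r', r * augElt F d ^ p ^ n * e = augElt F d ^ p ^ n * r'
  right : ∀ r, ∃ r', augElt F d ^ p ^ n * r * e = r' * augElt F d ^ p ^ n
  simple : ∀ (S : Type) [AddCommGroup S] [Module (MonoidAlgebra F Γ) S],
    IsSimpleModule (MonoidAlgebra F Γ) S → (∀ v : S, e • v = v) →
      ∀ v : S, augElt F d ^ p ^ n • v = 0

namespace CyclicTraceData

variable {p m n : ℕ} {e x : MonoidAlgebra F Γ} {d : Γ}

variable {V : Type} [AddCommGroup V] [Module (MonoidAlgebra F Γ) V]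

/-- The image of a power of `d - 1`, as a submodule. -/
def powSub (h : CyclicTraceData p m n e x d)
    (hV : ∀ v : V, e • v = v) : Submodule (MonoidAlgebra F Γ) V where
  carrier := {v | ∃ w, v = augElt F d ^ p ^ n • w}
  add_mem' := by
    rintro _ _ ⟨w, rfl⟩ ⟨w', rfl⟩
    exact ⟨w + w', (smul_add _ _ _).symm⟩
  zero_mem' := ⟨0, (smul_zero _).symm⟩
  smul_mem' := by
    rintro r _ ⟨w, rfl⟩
    obtain ⟨r', hr'⟩ := h.left r
    refine ⟨r' • w, ?_⟩
    rw [smul_smul, smul_smul, ← hr', mul_smul _ e, hV]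

lemma mem_powSub (h : CyclicTraceData p m n e x d)
    {hV : ∀ v : V, e • v = v} {v : V} :
    v ∈ h.powSub hV ↔ ∃ w, v = augElt F d ^ p ^ n • w := Iff.rfl

lemma quot (h : CyclicTraceData p m n e x d)
    {Q : Submodule (MonoidAlgebra F Γ) V} (hV : ∀ v : V, e • v = v) (v : V ⧸ Q) :
    e • v = v := by
  obtain ⟨v, rfl⟩ := Q.mkQ_surjective v
  rw [← map_smul, hV]

lemma sub (h : CyclicTraceData p m n e x d)
    {Q : Submodule (MonoidAlgebra F Γ) V} (hV : ∀ v : V, e • v = v) (v : Q) :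
    e • v = v := Subtype.ext (hV v)

lemma powSub_le (h : CyclicTraceData p m n e x d)
    {hV : ∀ v : V, e • v = v} {Q : Submodule (MonoidAlgebra F Γ) V}
    (hQ : IsCoatom Q) : h.powSub hV ≤ Q := by
  rintro _ ⟨w, rfl⟩
  have := h.simple (V ⧸ Q) (isSimpleModule_iff_isCoatom.2 hQ) (h.quot hV) (Q.mkQ w)
  rwa [← map_smul, Submodule.mkQ_apply, Submodule.Quotient.mk_eq_zero] at this

lemma quot_powSub (h : CyclicTraceData p m n e x d)
    {hV : ∀ v : V, e • v = v} (v : V ⧸ h.powSub hV) :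
    augElt F d ^ p ^ n • v = 0 := by
  obtain ⟨v, rfl⟩ := (h.powSub hV).mkQ_surjective v
  rw [← map_smul, Submodule.mkQ_apply, Submodule.Quotient.mk_eq_zero]
  exact ⟨v, rfl⟩

variable [Fact p.Prime] [CharP F p]

lemma augElt_pow_order (h : CyclicTraceData p m n e x d) : augElt F d ^ p ^ m = 0 := by
  rw [augElt_pow, ← h.order, pow_orderOf_eq_one, augElt, ← MonoidAlgebra.one_def, sub_self]

lemma powSub_ne_top (h : CyclicTraceData p m n e x d)
    [Nontrivial V] {hV : ∀ v : V, e • v = v} : h.powSub hV ≠ ⊤ := by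
  intro ht
  have key : ∀ (i : ℕ) (v : V), ∃ w, v = (augElt F d ^ p ^ n) ^ i • w := fun i => by
    induction i with
    | zero => exact fun v => ⟨v, by simp⟩
    | succ i ih =>
      intro v
      obtain ⟨w, hw⟩ := ih v
      obtain ⟨u, hu⟩ := h.mem_powSub.1 (ht ▸ Submodule.mem_top : w ∈ h.powSub hV)
      exact ⟨u, by rw [hw, hu, smul_smul, pow_succ]⟩
  obtain ⟨v, hv⟩ := exists_ne (0 : V)
  obtain ⟨w, hw⟩ := key (p ^ (m - n)) v
  apply hv
  rw [hw, ← pow_mul, ← pow_add, Nat.add_sub_cancel' h.lt.le, h.augElt_pow_order, zero_smul]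

lemma two_mul_le (h : CyclicTraceData p m n e x d) : 2 * p ^ n ≤ p ^ m := by
  have hp := (Fact.out : p.Prime)
  calc 2 * p ^ n ≤ p * p ^ n := Nat.mul_le_mul_right _ hp.two_le
    _ = p ^ (n + 1) := (pow_succ' p n).symm
    _ ≤ p ^ m := Nat.pow_le_pow_right hp.pos h.lt

variable [Module F V] [IsScalarTower F (MonoidAlgebra F Γ) V]
  [Finite Γ] [Module.Finite (MonoidAlgebra F Γ) V] [Module.Projective (MonoidAlgebra F Γ) V]

/-- The radical of a local projective module is zero or local. -/
lemma isLocalMod_radical (h : CyclicTraceData p m n e x d)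
    [FiniteDimensional F V] (hV : ∀ v : V, e • v = v)
    {Q : Submodule (MonoidAlgebra F Γ) V} (hQ : Q ≠ ⊤)
    (hQW : ∀ W : Submodule (MonoidAlgebra F Γ) V, W ≠ ⊤ → W ≤ Q) [Nontrivial Q] :
    IsLocalMod (MonoidAlgebra F Γ) Q := by
  have hpos : 0 < p ^ n := pow_pos (Fact.out : p.Prime).pos n
  have h2 := h.two_mul_le
  have hart : IsArtinianRing (MonoidAlgebra F Γ) := IsArtinianRing.of_finite F _
  have hart' : IsArtinian (MonoidAlgebra F Γ) V := inferInstance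
  have hnoe' : IsNoetherian (MonoidAlgebra F Γ) V := inferInstance
  have hco : IsCoatom Q := ⟨hQ, fun B hB => by
    by_contra hc
    exact hB.not_ge (hQW B hc)⟩
  have hτ : ∀ v : V, augElt F d ^ p ^ n • v ∈ Q := fun v => h.powSub_le (hV := hV) hco ⟨v, rfl⟩
  set τ := augElt F d ^ p ^ n with hτdef
  have hQe : ∀ v : Q, e • v = v := h.sub hV
  let K := h.powSub (V := Q) hQe
  let T := h.powSub hV
  have hTQ : T ≤ Q := h.powSub_le hco
  have hKtop : K ≠ ⊤ := h.powSub_ne_top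
  have : Nontrivial (Q ⧸ K) := Submodule.Quotient.nontrivial_iff.2 hKtop
  have : Nontrivial (V ⧸ T) := Submodule.Quotient.nontrivial_iff.2
    (fun hc => hQ (top_unique (hc ▸ hTQ)))
  have hend : ∀ (A : Type) [AddCommGroup A] [Module F A] [Module (MonoidAlgebra F Γ) A]
      [IsScalarTower F (MonoidAlgebra F Γ) A], (∀ a : A, τ • a = 0) → augEnd F A d ^ p ^ n = 0 :=
    fun A _ _ _ _ hA => LinearMap.ext fun a => by
      rw [augEnd_pow_apply]
      exact hA a
  obtain ⟨l, hl⟩ := exists_trace_eq_one (augEnd F (Q ⧸ K) d) (p ^ n) hpos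
      (hend _ h.quot_powSub) (by
    intro v hv
    rw [augEnd_pow_apply] at hv
    obtain ⟨q, rfl⟩ := K.mkQ_surjective v
    rw [← map_smul, Submodule.mkQ_apply, Submodule.Quotient.mk_eq_zero] at hv
    obtain ⟨q', hq'⟩ := hv
    have h0 : augElt F d ^ (p ^ n - 1) • ((q : V) - augElt F d • (q' : V)) = 0 := by
      have hq'' := congrArg Subtype.val hq'
      rw [smul_sub, smul_smul, ← pow_succ, Nat.sub_add_cancel hpos, sub_eq_zero]
      exact hq''
    obtain ⟨w, hw⟩ := mem_range_augElt_pow_of_smul_eq_zero p h.order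
      ((Nat.sub_le _ _).trans (by omega)) h0
    have hsplit : p ^ m - (p ^ n - 1) = 1 + (p ^ n + (p ^ m - 2 * p ^ n)) := by omega
    rw [hsplit, pow_add, pow_add, pow_one, mul_smul, mul_smul] at hw
    refine ⟨K.mkQ (q' + ⟨_, hτ (augElt F d ^ (p ^ m - 2 * p ^ n) • w)⟩), ?_⟩
    change _ = augElt F d • K.mkQ _
    rw [← map_smul]
    congr 1
    apply Subtype.ext
    change (q : V) = augElt F d • ((q' : V) + _)
    rw [smul_add, ← hw]
    abel)
  have htr : ∀ v : Q ⧸ K, trMapF F Γ (Subgroup.zpowers d) x • v = v := by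
    rw [h.trace]
    exact h.quot hQe
  let π : (Q ⧸ K) →ₗ[MonoidAlgebra F Γ] (V ⧸ T) := Submodule.mapQ K T Q.subtype (by
    rintro _ ⟨q, rfl⟩
    exact ⟨q, rfl⟩)
  have hkerπ : ∀ v ∈ LinearMap.ker π, ∃ y : V, v = K.mkQ ⟨τ • y, hτ y⟩ := fun v hv => by
    obtain ⟨q, rfl⟩ := K.mkQ_surjective v
    have : (q : V) ∈ T := by
      rw [← Submodule.Quotient.mk_eq_zero]
      exact hv
    obtain ⟨y, hy⟩ := this
    exact ⟨y, congrArg _ (Subtype.ext hy)⟩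
  have hsimple : ∀ A ≤ LinearMap.ker π, A ≠ ⊥ → LinearMap.ker π ≤ A := by
    intro A hA hAbot
    let B : Submodule (MonoidAlgebra F Γ) V :=
      { carrier := {y | K.mkQ ⟨τ • y, hτ y⟩ ∈ A}
        add_mem' := fun {a b} ha hb => by
          have := A.add_mem ha hb
          rw [← map_add] at this
          change K.mkQ _ ∈ A
          have he : (⟨τ • (a + b), hτ (a + b)⟩ : Q) = ⟨τ • a, hτ a⟩ + ⟨τ • b, hτ b⟩ :=
            Subtype.ext (smul_add _ _ _)
          rw [he]
          exact this
        zero_mem' := by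
          have he : (⟨τ • (0 : V), hτ 0⟩ : Q) = 0 := Subtype.ext (smul_zero _)
          change K.mkQ _ ∈ A
          rw [he, map_zero]
          exact A.zero_mem
        smul_mem' := fun r a ha => by
          obtain ⟨r', hr'⟩ := h.right r
          have := A.smul_mem r' ha
          rw [← map_smul] at this
          have he : (⟨τ • (r • a), hτ (r • a)⟩ : Q) = r' • ⟨τ • a, hτ a⟩ := Subtype.ext (by
            change τ • (r • a) = r' • (τ • a)
            rw [smul_smul, smul_smul, hτdef, ← hr', mul_smul _ e, hV])
          change K.mkQ _ ∈ A
          rw [he]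
          exact this }
    by_cases hB : B = ⊤
    · intro v hv
      obtain ⟨y, rfl⟩ := hkerπ v hv
      exact (hB ▸ Submodule.mem_top : y ∈ B)
    · exfalso
      apply hAbot
      rw [eq_bot_iff]
      intro a ha
      obtain ⟨y, rfl⟩ := hkerπ a (hA ha)
      have hyQ : y ∈ Q := hQW B hB ha
      rw [Submodule.mem_bot, Submodule.mkQ_apply, Submodule.Quotient.mk_eq_zero]
      exact ⟨⟨y, hyQ⟩, rfl⟩
  have hVTloc : IsLocalMod (MonoidAlgebra F Γ) (V ⧸ T) :=
    IsLocalMod.of_surjective ⟨Q, hQ, hQW⟩ T.mkQ T.mkQ_surjective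
  have hsummand : ∀ A B : Submodule (MonoidAlgebra F Γ) (Q ⧸ K), IsCompl A B → A ≠ ⊥ →
      LinearMap.ker π ⊓ A ≠ ⊥ := by
    intro A B hAB hA hbot
    let f : A →ₗ[MonoidAlgebra F Γ] (V ⧸ T) := π.comp A.subtype
    have hf : Function.Injective f := by
      rw [← LinearMap.ker_eq_bot, eq_bot_iff]
      intro a ha
      have : (a : Q ⧸ K) ∈ LinearMap.ker π ⊓ A := ⟨ha, a.2⟩
      rw [hbot, Submodule.mem_bot] at this
      exact Subtype.ext this
    obtain ⟨g, hg⟩ := exists_extension (x := x) h.fixed htr hl (hend _ h.quot_powSub)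
      (hend _ h.quot_powSub) f hf A.subtype
    let θ : (V ⧸ T) →ₗ[MonoidAlgebra F Γ] A := (Submodule.projectionOnto A B hAB).comp g
    have hθ : ∀ a, θ (f a) = a := fun a => by
      have := LinearMap.congr_fun hg a
      change Submodule.projectionOnto A B hAB (g (f a)) = a
      rw [LinearMap.comp_apply] at this
      rw [this]
      exact Submodule.projectionOnto_apply_left hAB a
    have hsup : LinearMap.range f ⊔ LinearMap.ker θ = ⊤ := top_unique fun v _ => by
      rw [← sub_add_cancel v (f (θ v)), add_comm]
      exact Submodule.add_mem_sup ⟨_, rfl⟩ (by simp [hθ])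
    rcases hVTloc.eq_top_or_eq_top hsup with hc | hc
    · apply hQ
      refine top_unique fun v _ => ?_
      obtain ⟨a, ha⟩ := (hc ▸ Submodule.mem_top : T.mkQ v ∈ LinearMap.range f)
      obtain ⟨q, hq⟩ := K.mkQ_surjective a
      have : T.mkQ (q : V) = T.mkQ v := by
        rw [← ha]
        change _ = π a
        rw [← hq]
        rfl
      have := (Submodule.Quotient.eq T).1 this
      have := sub_mem q.2 (hTQ this)
      simpa using this
    · apply hA
      rw [eq_bot_iff]
      intro a ha
      have := hθ ⟨a, ha⟩
      rw [LinearMap.ker_eq_top.1 hc] at this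
      exact (congrArg Subtype.val this).symm
  have hQKloc : IsLocalMod (MonoidAlgebra F Γ) (Q ⧸ K) := by
    refine isLocalMod_of_lifts ?_ ?_
    · intro W U hWU
      obtain ⟨g, hg⟩ := exists_lift (x := x) h.fixed htr hl (hend _ h.quot_powSub)
        (W := W) (hend _ fun w => Subtype.ext (h.quot_powSub _)) (U.mkQ.comp W.subtype) (by
          intro z
          obtain ⟨z, rfl⟩ := U.mkQ_surjective z
          obtain ⟨w, hw, u, hu, rfl⟩ := Submodule.mem_sup.1
            (hWU ▸ Submodule.mem_top : z ∈ W ⊔ U)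
          refine ⟨⟨w, hw⟩, ?_⟩
          simpa [Submodule.Quotient.eq] using hu) U.mkQ
      refine ⟨W.subtype.comp g, fun v => (g v).2, fun v => ?_⟩
      rw [← Submodule.Quotient.eq]
      exact LinearMap.congr_fun hg v
    · intro A B hAB
      by_contra! hc
      have h1 := hsummand A B hAB hc.1
      have h2 := hsummand B A hAB.symm hc.2
      have h3 := hsimple _ inf_le_left h1
      have h4 := hsimple _ inf_le_left h2
      apply h1
      rw [eq_bot_iff]
      refine le_trans ?_ hAB.inf_eq_bot.le
      exact le_inf inf_le_right (inf_le_left.trans (h4.trans inf_le_right))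
  obtain ⟨U, hU, hUW⟩ := hQKloc
  refine ⟨U.comap K.mkQ, fun hc => hU ?_, fun W hW => ?_⟩
  · refine top_unique fun v _ => ?_
    obtain ⟨q, rfl⟩ := K.mkQ_surjective v
    exact (hc ▸ Submodule.mem_top : q ∈ U.comap K.mkQ)
  · obtain ⟨W', hW', hWW'⟩ := (eq_top_or_exists_le_coatom W).resolve_left hW
    have hKW : K ≤ W' := h.powSub_le hW'
    refine hWW'.trans (Submodule.map_le_iff_le_comap.1 (hUW _ fun hc => hW'.1 ?_))
    have := Submodule.comap_map_mkQ K W'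
    rw [hc, Submodule.comap_top, sup_eq_right.2 hKW] at this
    exact this.symm

end CyclicTraceData

end CyclicDefectFinite

section FiniteUniserial

variable {F Γ : Type} [Field F] [Group Γ] [Finite Γ] {p : ℕ} [Fact p.Prime] [CharP F p]

/-- A local module in a block with non-trivial cyclic trace data is uniserial. -/
lemma CyclicTraceData.uniserial {m n : ℕ} {e x : MonoidAlgebra F Γ} {d : Γ}
    (h : CyclicTraceData p m n e x d) {X : Type} [AddCommGroup X] [Module F X]
    [Module (MonoidAlgebra F Γ) X] [IsScalarTower F (MonoidAlgebra F Γ) X]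
    [FiniteDimensional F X] (hX : ∀ v : X, e • v = v) (hloc : IsLocalMod (MonoidAlgebra F Γ) X) :
    Uniserial (MonoidAlgebra F Γ) X := by
  have hart : IsArtinianRing (MonoidAlgebra F Γ) := IsArtinianRing.of_finite F _
  have hnoe : IsNoetherianRing (MonoidAlgebra F Γ) := inferInstance
  induction hr : Module.finrank F X using Nat.strong_induction_on generalizing X with
  | _ r ih =>
  obtain ⟨U, hU, hUW⟩ := hloc
  refine Uniserial.of_greatest hUW ?_
  obtain ⟨L, f, hL, hf, hLW⟩ := IsLocalMod.exists_projective_cover hU hUW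
  have hrange : ∀ W : Submodule (MonoidAlgebra F Γ) L, W = ⊤ ∨ W ≤ U.comap f := fun W =>
    or_iff_not_imp_left.2 (hLW W)
  have hLe : ∀ v : L, e • v = v := by
    let E : Submodule (MonoidAlgebra F Γ) L :=
      { carrier := {v | e • v = v}
        add_mem' := fun {a b} ha hb => by
          change e • (a + b) = a + b
          rw [smul_add, ha, hb]
        zero_mem' := smul_zero _
        smul_mem' := fun r a ha => by
          change e • r • a = r • a
          rw [smul_smul, ← h.central, mul_smul, ha] }
    have hE : ∀ v, e • v ∈ E := fun v => by
      change e • e • v = e • v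
      rw [smul_smul, h.idem]
    rcases hrange E with hc | hc
    · exact fun v => (hc ▸ Submodule.mem_top : v ∈ E)
    · refine absurd (top_unique fun y _ => ?_) hU
      obtain ⟨v, rfl⟩ := hf y
      have := hc (hE v)
      rwa [Submodule.mem_comap, map_smul, hX] at this
  have hQ : U.comap f ≠ ⊤ := fun hc => hU <| top_unique fun y _ => by
    obtain ⟨v, rfl⟩ := hf y
    exact (hc ▸ Submodule.mem_top : v ∈ U.comap f)
  let g : U.comap f →ₗ[MonoidAlgebra F Γ] U := f.restrict fun _ hv => hv
  have hg : Function.Surjective g := fun u => by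
    obtain ⟨v, hv⟩ := hf u
    exact ⟨⟨v, by rw [Submodule.mem_comap, hv]; exact u.2⟩, Subtype.ext hv⟩
  rcases subsingleton_or_nontrivial U with hs | hn
  · exact fun W W' => Or.inl fun w hw => by
      rw [Subsingleton.elim w 0]
      exact W'.zero_mem
  · have : Nontrivial (U.comap f) := hg.nontrivial
    have hfin : Module.Finite (MonoidAlgebra F Γ) L := inferInstance
    have hfinF : FiniteDimensional F L := inferInstanceAs
      (FiniteDimensional F (L.restrictScalars F))
    have hUF : FiniteDimensional F U := inferInstanceAs (FiniteDimensional F (U.restrictScalars F))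
    have hlt : Module.finrank F U < Module.finrank F X :=
      Submodule.finrank_lt (s := U.restrictScalars F)
        (fun hc => hU (top_unique fun y _ => (hc ▸ Submodule.mem_top : y ∈ U.restrictScalars F)))
    exact ih _ (hr ▸ hlt) (fun v => Subtype.ext (hX v))
      ((h.isLocalMod_radical hLe hQ hLW).of_surjective g hg) rfl

end FiniteUniserial

section NormalAction

variable {F Γ : Type} [Field F] [Group Γ] [Finite Γ] {p : ℕ} [Fact p.Prime] [CharP F p]

lemma relIndex_sup_left_of_normal (D N : Subgroup Γ) [N.Normal] :
    D.relIndex (D ⊔ N) = D.relIndex N := by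
  have h1 := Subgroup.relIndex_mul_relIndex (D ⊓ N) D (D ⊔ N) inf_le_left le_sup_left
  have h2 := Subgroup.relIndex_mul_relIndex (D ⊓ N) N (D ⊔ N) inf_le_right le_sup_right
  rw [Subgroup.inf_relIndex_left] at h1
  rw [Subgroup.inf_relIndex_right, Subgroup.relIndex_sup_right, ← h1, mul_comm] at h2
  have h3 : N.relIndex D ≠ 0 := Subgroup.index_ne_zero_of_finite
  exact (Nat.eq_of_mul_eq_mul_left (Nat.pos_of_ne_zero h3) h2).symm

/-- If a block with trace from `D` has a module on which the normal subgroup `N` acts trivially,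
then the index of `D ∩ N` in `N` is prime to the characteristic. -/
lemma not_dvd_relIndex {D N : Subgroup Γ} [N.Normal] {x : MonoidAlgebra F Γ}
    (hx : x ∈ fixedByF F Γ D) {V : Type} [AddCommGroup V] [Module F V]
    [Module (MonoidAlgebra F Γ) V] [IsScalarTower F (MonoidAlgebra F Γ) V]
    (hN : ∀ ν ∈ N, ∀ v : V, MonoidAlgebra.single ν (1 : F) • v = v) {v : V} (hv : v ≠ 0)
    (htr : trMapF F Γ D x • v = v) : ¬ p ∣ D.relIndex N := by
  intro hp
  apply hv
  rw [← htr, trMapF_smul]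
  let T : Γ → V := fun g => traceTerm x LinearMap.id g v
  have hT : ∀ g, ∀ h ∈ D ⊔ N, T (g * h) = T g := by
    intro g h hh
    obtain ⟨ν, hν, δ, hδ, rfl⟩ := (Subgroup.mem_sup_of_normal_left).1 ((sup_comm D N) ▸ hh)
    have h1 : T (g * (ν * δ)) = T (g * ν) := by
      simp only [T]
      rw [← mul_assoc, traceTerm_mul_right hx (fun h _ v => rfl) _ hδ]
    rw [h1]
    simp only [T, traceTerm_apply, LinearMap.id_apply]
    rw [mul_inv_rev, ← single_smul_single_smul, hN _ (inv_mem hν), mul_smul,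
      ← single_smul_single_smul, hN ν hν, mul_smul]
  have := Fintype.ofFinite (Γ ⧸ D)
  have := Fintype.ofFinite (Γ ⧸ (D ⊔ N))
  have := Fintype.ofFinite (↥(D ⊔ N) ⧸ D.subgroupOf (D ⊔ N))
  let E := Subgroup.quotientEquivProdOfLE (le_sup_left : D ≤ D ⊔ N)
  have hE : ∀ c : Γ ⧸ D, T (Quotient.out c) = T (Quotient.out (E c).1) := by
    intro c
    have h1 : (E c).1 = ((Quotient.out c : Γ) : Γ ⧸ (D ⊔ N)) := by
      conv_lhs => rw [← QuotientGroup.out_eq' c]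
      rfl
    have h2 := QuotientGroup.eq.1 ((QuotientGroup.out_eq' (E c).1).trans h1)
    rw [← hT (Quotient.out (E c).1) _ h2, mul_inv_cancel_left]
  rw [finsum_eq_sum_of_fintype]
  change ∑ c : Γ ⧸ D, T (Quotient.out c) = 0
  rw [Finset.sum_congr rfl fun c _ => hE c,
    Equiv.sum_comp E (fun z => T (Quotient.out z.1)), Fintype.sum_prod_type]
  simp only [Finset.sum_const, Finset.card_univ]
  rw [← Finset.smul_sum, ← Nat.card_eq_fintype_card]
  change D.relIndex (D ⊔ N) • _ = _
  rw [relIndex_sup_left_of_normal, ← Nat.cast_smul_eq_nsmul F, (CharP.cast_eq_zero_iff F p _).2 hp,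
    zero_smul]

lemma exists_pow_single_mul_eq {e : MonoidAlgebra F Γ} (he : e * e = e)
    (hc : ∀ r, r * e = e * r) {ν : Γ}
    (hν : ∀ (S : Type) [AddCommGroup S] [Module (MonoidAlgebra F Γ) S],
      IsSimpleModule (MonoidAlgebra F Γ) S → (∀ v : S, e • v = v) →
        ∀ v : S, MonoidAlgebra.single ν (1 : F) • v = v) :
    ∃ r, MonoidAlgebra.single (ν ^ p ^ r) (1 : F) * e = e := by
  have hart : IsArtinianRing (MonoidAlgebra F Γ) := IsArtinianRing.of_finite F _
  have hmem : augElt F ν * e ∈ Ring.jacobson (MonoidAlgebra F Γ) := by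
    rw [Ring.jacobson, Module.jacobson, Submodule.mem_sInf]
    intro M hM
    have hS : IsSimpleModule (MonoidAlgebra F Γ) (MonoidAlgebra F Γ ⧸ M) :=
      isSimpleModule_iff_isCoatom.2 hM
    let E : Submodule (MonoidAlgebra F Γ) (MonoidAlgebra F Γ ⧸ M) :=
      { carrier := {v | e • v = v}
        add_mem' := fun {a b} ha hb => by
          change e • (a + b) = a + b
          rw [smul_add, ha, hb]
        zero_mem' := smul_zero _
        smul_mem' := fun r a ha => by
          change e • r • a = r • a
          rw [smul_smul, ← hc, mul_smul, ha] }
    have hE : ∀ v, e • v ∈ E := fun v => by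
      change e • e • v = e • v
      rw [smul_smul, he]
    have key : (augElt F ν * e) • M.mkQ 1 = 0 := by
      rcases eq_bot_or_eq_top E with h | h
      · have := hE (M.mkQ 1)
        rw [h, Submodule.mem_bot] at this
        rw [mul_smul, this, smul_zero]
      · have := hν _ hS (fun v => (h ▸ Submodule.mem_top : v ∈ E)) (e • M.mkQ 1)
        rw [mul_smul, augElt_smul, this, sub_self]
    rwa [← map_smul, smul_eq_mul, mul_one, Submodule.mkQ_apply,
      Submodule.Quotient.mk_eq_zero] at key
  obtain ⟨s, hs⟩ := IsArtinianRing.isNilpotent_jacobson_bot (R := MonoidAlgebra F Γ)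
  rw [Ideal.jacobson_bot] at hs
  have h0 : (augElt F ν * e) ^ p ^ s = 0 := by
    have h1 : (augElt F ν * e) ^ s = 0 := by
      have := Ideal.pow_mem_pow hmem s
      rw [hs] at this
      exact this
    exact pow_eq_zero_of_le (Nat.lt_pow_self (Fact.out : p.Prime).one_lt).le h1
  refine ⟨s, ?_⟩
  have hpos : p ^ s ≠ 0 := pow_ne_zero _ (Fact.out : p.Prime).ne_zero
  have hidem : IsIdempotentElem e := he
  rw [(show Commute (augElt F ν) e from hc _).mul_pow, hidem.pow_eq hpos, augElt_pow, augElt,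
    sub_mul, one_mul, sub_eq_zero] at h0
  exact h0

end NormalAction

section BuildData

variable {F Γ : Type} [Field F] [Group Γ] [Finite Γ] {p : ℕ} [Fact p.Prime] [CharP F p]

lemma exists_pow_mul_eq_of_isPGroup_quotient {N K : Subgroup Γ} [K.Normal] {D : Subgroup Γ}
    (hp : ¬ p ∣ D.relIndex N) (hK : ∀ ν ∈ N, ∃ r, ν ^ p ^ r ∈ K) {ν : Γ} (hν : ν ∈ N) :
    ∃ δ ∈ D ⊓ N, δ⁻¹ * ν ∈ K := by
  let Q := N ⧸ K.subgroupOf N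
  have hQ : IsPGroup p Q := fun q => by
    obtain ⟨ν, rfl⟩ := QuotientGroup.mk'_surjective _ q
    obtain ⟨r, hr⟩ := hK ν ν.2
    refine ⟨r, ?_⟩
    rw [← map_pow]
    exact (QuotientGroup.eq_one_iff _).2 hr
  let I := (D.subgroupOf N).map (QuotientGroup.mk' (K.subgroupOf N))
  have hdvd : I.index ∣ D.relIndex N :=
    Subgroup.index_map_dvd _ (QuotientGroup.mk'_surjective _)
  obtain ⟨n, hn⟩ := hQ.index I
  have hn0 : n = 0 := by
    by_contra h
    exact hp ((dvd_pow_self p h).trans (hn ▸ hdvd))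
  rw [hn0, pow_zero, Subgroup.index_eq_one] at hn
  obtain ⟨δ, hδ, hδν⟩ := (hn ▸ Subgroup.mem_top _ :
    QuotientGroup.mk' (K.subgroupOf N) ⟨ν, hν⟩ ∈ I)
  exact ⟨δ, ⟨hδ, δ.2⟩, (QuotientGroup.eq (s := K.subgroupOf N)).1 hδν⟩

lemma exists_simple_of_ne_zero {e : MonoidAlgebra F Γ} (he : e * e = e)
    (hc : ∀ r, r * e = e * r) (h0 : e ≠ 0) :
    ∃ (S : Type) (_ : AddCommGroup S) (_ : Module (MonoidAlgebra F Γ) S),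
      IsSimpleModule (MonoidAlgebra F Γ) S ∧ ∀ v : S, e • v = v := by
  have hart : IsArtinianRing (MonoidAlgebra F Γ) := IsArtinianRing.of_finite F _
  let B : Submodule (MonoidAlgebra F Γ) (MonoidAlgebra F Γ) := Submodule.span _ {e}
  have hB : Nontrivial B := ⟨⟨⟨e, Submodule.mem_span_singleton_self e⟩, 0, fun h =>
    h0 (congrArg Subtype.val h)⟩⟩
  obtain ⟨M, hM, -⟩ := (eq_top_or_exists_le_coatom
    (⊥ : Submodule (MonoidAlgebra F Γ) B)).resolve_left bot_ne_top
  refine ⟨B ⧸ M, inferInstance, inferInstance, isSimpleModule_iff_isCoatom.2 hM, fun v => ?_⟩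
  obtain ⟨⟨b, hb⟩, rfl⟩ := M.mkQ_surjective v
  rw [← map_smul]
  congr 1
  apply Subtype.ext
  obtain ⟨r, rfl⟩ := Submodule.mem_span_singleton.1 hb
  change e * (r * e) = r * e
  rw [hc r, ← mul_assoc, he]

/-- The trace data of a finite group algebra at a normal subgroup acting trivially on the simple
modules of `e` and meeting the cyclic group non-trivially. -/
lemma exists_cyclicTraceData {e x : MonoidAlgebra F Γ} {d : Γ} {m : ℕ} {N : Subgroup Γ}
    [N.Normal] (he : e * e = e) (hc : ∀ r, r * e = e * r) (h0 : e ≠ 0)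
    (hx : x ∈ fixedByF F Γ (Subgroup.zpowers d)) (htr : trMapF F Γ (Subgroup.zpowers d) x = e)
    (hd : orderOf d = p ^ m)
    (hN : ∀ (S : Type) [AddCommGroup S] [Module (MonoidAlgebra F Γ) S],
      IsSimpleModule (MonoidAlgebra F Γ) S → (∀ v : S, e • v = v) →
        ∀ ν ∈ N, ∀ v : S, MonoidAlgebra.single ν (1 : F) • v = v)
    {i : ℕ} (hi : d ^ i ∈ N) (hi1 : d ^ i ≠ 1) :
    ∃ n, CyclicTraceData p m n e x d := by
  have hp : p.Prime := Fact.out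
  obtain ⟨n, hnm, hn⟩ := (Nat.dvd_prime_pow hp).1
    (hd ▸ orderOf_map_dvd (QuotientGroup.mk' N) d)
  have hmemN : ∀ i, d ^ i ∈ N ↔ p ^ n ∣ i := fun i => by
    rw [← hn, orderOf_dvd_iff_pow_eq_one, ← map_pow]
    exact (QuotientGroup.eq_one_iff _).symm
  have hlt : n < m := lt_of_le_of_ne hnm fun h => hi1 <| by
    have := (hmemN i).1 hi
    rwa [h, ← hd, orderOf_dvd_iff_pow_eq_one] at this
  have hndvd : ¬ p ∣ (Subgroup.zpowers d).relIndex N := by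
    obtain ⟨S, _, _, hS, hSe⟩ := exists_simple_of_ne_zero he hc h0
    let : Module F S := Module.compHom S (algebraMap F (MonoidAlgebra F Γ))
    have : IsScalarTower F (MonoidAlgebra F Γ) S := ⟨fun a b z => by
      rw [Algebra.smul_def, mul_smul]; rfl⟩
    have := IsSimpleModule.nontrivial (MonoidAlgebra F Γ) S
    obtain ⟨v, hv⟩ := exists_ne (0 : S)
    exact not_dvd_relIndex hx (hN S hS hSe) hv (htr ▸ hSe v)
  let K : Subgroup Γ :=
    { carrier := {g | MonoidAlgebra.single g (1 : F) * e = e}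
      mul_mem' := fun {a b} ha hb => by
        change MonoidAlgebra.single (a * b) (1 : F) * e = e
        rw [← one_mul (1 : F), ← MonoidAlgebra.single_mul_single, mul_assoc, hb, ha]
      one_mem' := by
        change MonoidAlgebra.single 1 (1 : F) * e = e
        rw [← MonoidAlgebra.one_def, one_mul]
      inv_mem' := fun {a} ha => by
        change MonoidAlgebra.single a⁻¹ (1 : F) * e = e
        nth_rewrite 1 [← (ha : MonoidAlgebra.single a (1 : F) * e = e)]
        rw [← mul_assoc, MonoidAlgebra.single_mul_single, inv_mul_cancel, one_mul,
          ← MonoidAlgebra.one_def, one_mul] }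
  have hKn : K.Normal := ⟨fun a ha g => by
    change MonoidAlgebra.single (g * a * g⁻¹) (1 : F) * e = e
    have h1 : MonoidAlgebra.single (g * a * g⁻¹) (1 : F) =
        MonoidAlgebra.single g 1 * MonoidAlgebra.single a 1 * MonoidAlgebra.single g⁻¹ 1 := by
      simp [MonoidAlgebra.single_mul_single]
    rw [h1, mul_assoc, hc, ← mul_assoc, mul_assoc _ _ e, ha, mul_assoc, ← hc, ← mul_assoc,
      MonoidAlgebra.single_mul_single, mul_inv_cancel, one_mul, ← MonoidAlgebra.one_def, one_mul]⟩
  have hact : ∀ ν ∈ N, ∃ l, MonoidAlgebra.single ν (1 : F) * e =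
      MonoidAlgebra.single ((d ^ p ^ n) ^ l) (1 : F) * e := by
    intro ν hν
    obtain ⟨δ, ⟨hδD, hδN⟩, hδν⟩ := exists_pow_mul_eq_of_isPGroup_quotient (K := K) hndvd
      (fun ν hν => exists_pow_single_mul_eq he hc fun S _ _ hS hSe => hN S hS hSe ν hν) hν
    obtain ⟨i, rfl⟩ := (Submonoid.mem_powers_iff _ _).1 (mem_powers_iff_mem_zpowers.2 hδD)
    obtain ⟨l, rfl⟩ := (hmemN _).1 hδN
    refine ⟨l, ?_⟩
    rw [← pow_mul]
    conv_rhs => rw [← (hδν : MonoidAlgebra.single _ (1 : F) * e = e), ← mul_assoc,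
      MonoidAlgebra.single_mul_single, mul_inv_cancel_left, one_mul]
  have haN : d ^ p ^ n ∈ N := (hmemN _).2 dvd_rfl
  have hτ : augElt F d ^ p ^ n = MonoidAlgebra.single (d ^ p ^ n) 1 - 1 := by
    rw [augElt_pow, augElt]
  have hcs : ∀ g, MonoidAlgebra.single g (1 : F) * e = e * MonoidAlgebra.single g 1 := fun g => hc _
  have hcs' : ∀ g y, MonoidAlgebra.single g (1 : F) * (e * y) =
      e * (MonoidAlgebra.single g 1 * y) := fun g y => by rw [← mul_assoc, hcs, mul_assoc]
  refine ⟨n, he, hc, hx, htr, hd, hlt, fun r => ?_, fun r => ?_, fun S _ _ hS hSe v => ?_⟩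
  · induction r using MonoidAlgebra.induction_on with
    | of g =>
      obtain ⟨l, hl⟩ := hact _ (‹N.Normal›.conj_mem _ haN g)
      refine ⟨(∑ i ∈ Finset.range l, MonoidAlgebra.single (d ^ p ^ n) (1 : F) ^ i) * e *
        MonoidAlgebra.single g 1, ?_⟩
      rw [hτ, ← mul_assoc, ← mul_assoc, mul_geom_sum, MonoidAlgebra.single_pow, one_pow, sub_mul,
        ← hl, MonoidAlgebra.of_apply]
      simp [hcs, hcs', mul_assoc, sub_mul, mul_sub, MonoidAlgebra.single_mul_single]
    | add a b ha hb =>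
      obtain ⟨a', ha⟩ := ha
      obtain ⟨b', hb⟩ := hb
      exact ⟨a' + b', by rw [mul_add, ← ha, ← hb, add_mul, add_mul]⟩
    | smul c a ha =>
      obtain ⟨a', ha⟩ := ha
      exact ⟨c • a', by rw [mul_smul_comm, ← ha, smul_mul_assoc, smul_mul_assoc]⟩
  · induction r using MonoidAlgebra.induction_on with
    | of g =>
      obtain ⟨l, hl⟩ := hact _ (‹N.Normal›.conj_mem _ haN g⁻¹)
      refine ⟨MonoidAlgebra.single g 1 * e *
        (∑ i ∈ Finset.range l, MonoidAlgebra.single (d ^ p ^ n) (1 : F) ^ i), ?_⟩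
      rw [hcs, hcs] at hl
      rw [hτ, mul_assoc _ _ (_ - _), geom_sum_mul, MonoidAlgebra.single_pow, one_pow, mul_assoc,
        mul_assoc, mul_sub e, ← hl, mul_one, MonoidAlgebra.of_apply]
      simp [hcs, hcs', mul_assoc, sub_mul, mul_sub, MonoidAlgebra.single_mul_single]
    | add a b ha hb =>
      obtain ⟨a', ha⟩ := ha
      obtain ⟨b', hb⟩ := hb
      exact ⟨a' + b', by rw [add_mul, ← ha, ← hb, mul_add, add_mul]⟩
    | smul c a ha =>
      obtain ⟨a', ha⟩ := ha
      exact ⟨c • a', by rw [smul_mul_assoc, ← ha, mul_smul_comm, smul_mul_assoc]⟩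
  · rw [augElt_pow, augElt_smul, hN S hS hSe _ haN, sub_self]

end BuildData

section PseudocompactTheory

variable {k : Type} [Field k] {A : Type} [Ring A] [Algebra k A] [TopologicalSpace A]
  {X : Type} [AddCommGroup X] [Module k X] [Module A X] [IsScalarTower k A X]
  [TopologicalSpace X]
  {Y : Type} [AddCommGroup Y] [Module k Y] [Module A Y] [IsScalarTower k A Y]
  [TopologicalSpace Y]

lemma finiteDimensional_quotient_of_ker_le {Z : Type} [AddCommGroup Z] [Module k Z] [Module A Z]
    [IsScalarTower k A Z] [FiniteDimensional k Z] (f : X →ₗ[A] Z) {V : Submodule A X}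
    (h : LinearMap.ker f ≤ V) : FiniteDimensional k (X ⧸ V.restrictScalars k) := by
  let f' := f.restrictScalars k
  have h' : LinearMap.ker f' ≤ V.restrictScalars k := fun x hx => h hx
  have : FiniteDimensional k (X ⧸ LinearMap.ker f') :=
    Module.Finite.equiv f'.quotKerEquivRange.symm
  exact Module.Finite.of_surjective (Submodule.factor h') (Submodule.factor_surjective h')

lemma isOpen_of_le [IsTopologicalAddGroup X] {V W : Submodule A X} (h : V ≤ W)
    (hV : IsOpen (V : Set X)) : IsOpen (W : Set X) :=
  AddSubgroup.isOpen_mono (H₁ := V.toAddSubgroup) (H₂ := W.toAddSubgroup) h hV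

lemma isClosed_of_isOpen_submodule [IsTopologicalAddGroup X] {V : Submodule A X}
    (hV : IsOpen (V : Set X)) : IsClosed (V : Set X) :=
  AddSubgroup.isClosed_of_isOpen V.toAddSubgroup hV

namespace IsPseudocompactMod

lemma exists_open_le (hX : IsPseudocompactMod k A X)
    {V : Submodule A X} (hV : IsOpen (V : Set X)) :
    ∃ W ≤ V, IsOpen (W : Set X) ∧ FiniteDimensional k (X ⧸ W.restrictScalars k) := by
  obtain ⟨W, hW, hWV⟩ := hX.basis.mem_iff.1 (hV.mem_nhds V.zero_mem)
  exact ⟨W, hWV, hW⟩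

lemma finite_restrictScalars (hX : IsPseudocompactMod k A X)
    {V : Submodule A X} (hV : IsOpen (V : Set X)) :
    FiniteDimensional k (X ⧸ V.restrictScalars k) := by
  obtain ⟨W, hWV, -, hW⟩ := hX.exists_open_le hV
  have h' : W.restrictScalars k ≤ V.restrictScalars k := hWV
  exact Module.Finite.of_surjective (Submodule.factor h') (Submodule.factor_surjective h')

lemma finite_quotient (hX : IsPseudocompactMod k A X)
    {V : Submodule A X} (hV : IsOpen (V : Set X)) :
    FiniteDimensional k (X ⧸ V) := by
  have := hX.finite_restrictScalars hV
  exact Module.Finite.equiv (Submodule.Quotient.restrictScalarsEquiv k V)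

lemma mem_of_forall_open (hX : IsPseudocompactMod k A X)
    {W : Submodule A X} (hW : IsClosed (W : Set X)) {x : X}
    (h : ∀ V : Submodule A X, IsOpen (V : Set X) → x ∈ W ⊔ V) : x ∈ W := by
  have := hX.addGroup
  change x ∈ (W : Set X)
  rw [← hW.closure_eq, mem_closure_iff_nhds]
  intro t ht
  have h0 : (fun y => x + y) ⁻¹' t ∈ nhds (0 : X) := by
    apply (continuous_const.add continuous_id).continuousAt.preimage_mem_nhds
    simpa using ht
  obtain ⟨V, hV, hVt⟩ := hX.basis.mem_iff.1 h0
  obtain ⟨w, hw, v, hv, rfl⟩ := Submodule.mem_sup.1 (h V hV.1)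
  refine ⟨w, ?_, hw⟩
  have : (w + v) + -v ∈ t := hVt (V.neg_mem hv)
  simpa using this

variable (A) in
/-- A coset of a closed submodule. -/
def IsClosedCoset (s : Set X) : Prop :=
  ∃ (x : X) (L : Submodule A X), IsClosed (L : Set X) ∧ ∀ y, y ∈ s ↔ y - x ∈ L

lemma IsClosedCoset.inter {s t : Set X} (hs : IsClosedCoset A s) (ht : IsClosedCoset A t)
    (hst : (s ∩ t).Nonempty) : IsClosedCoset A (s ∩ t) := by
  obtain ⟨x, L, hL, hs⟩ := hs
  obtain ⟨y, M, hM, ht⟩ := ht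
  obtain ⟨z, hzs, hzt⟩ := hst
  refine ⟨z, L ⊓ M, hL.inter hM, fun w => ?_⟩
  rw [Set.mem_inter_iff, hs, ht, Submodule.mem_inf]
  have h1 : w - x = (w - z) + (z - x) := by abel
  have h2 : w - y = (w - z) + (z - y) := by abel
  rw [h1, h2, Submodule.add_mem_iff_left _ ((hs z).1 hzs),
    Submodule.add_mem_iff_left _ ((ht z).1 hzt)]

/-- Linear compactness: a directed family of cosets of closed submodules has a common point. -/
lemma exists_mem_cosets (hX : IsPseudocompactMod k A X)
    {ι : Type} [Nonempty ι] (s : ι → Set X)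
    (hcc : ∀ i, IsClosedCoset A (s i)) (hne : ∀ i, (s i).Nonempty)
    (hdir : ∀ i j, ∃ l, s l ⊆ s i ∧ s l ⊆ s j) : ∃ x, ∀ i, x ∈ s i := by
  have := hX.addGroup
  let Good : Set (Set (Set X)) := {M | (∀ c ∈ M, IsClosedCoset A c ∧ c.Nonempty) ∧
    ∀ c ∈ M, ∀ c' ∈ M, c ∩ c' ∈ M}
  let M₀ : Set (Set X) := {c | IsClosedCoset A c ∧ ∃ i, s i ⊆ c}
  have hM₀ : M₀ ∈ Good := by
    refine ⟨fun c hc => ⟨hc.1, hc.2.elim fun i hi => (hne i).mono hi⟩, fun c hc c' hc' => ?_⟩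
    obtain ⟨hc, i, hi⟩ := hc
    obtain ⟨hc', j, hj⟩ := hc'
    obtain ⟨l, hl, hl'⟩ := hdir i j
    have hsub : s l ⊆ c ∩ c' := Set.subset_inter (hl.trans hi) (hl'.trans hj)
    exact ⟨hc.inter hc' ((hne l).mono hsub), l, hsub⟩
  obtain ⟨M, hM₀M, hM⟩ := zorn_subset_nonempty Good (fun C hC hchain hCne => by
    refine ⟨⋃₀ C, ⟨fun c ⟨M, hM, hc⟩ => (hC hM).1 c hc, ?_⟩, fun M hM => Set.subset_sUnion_of_mem hM⟩
    rintro c ⟨M, hM, hc⟩ c' ⟨M', hM', hc'⟩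
    rcases hchain.total hM hM' with h | h
    · exact ⟨M', hM', (hC hM').2 c (h hc) c' hc'⟩
    · exact ⟨M, hM, (hC hM).2 c hc c' (h hc')⟩) M₀ hM₀
  have hMgood : M ∈ Good := hM.prop
  have hadd : ∀ c, IsClosedCoset A c → (∀ m ∈ M, (m ∩ c).Nonempty) → c ∈ M := by
    intro c hc hmc
    have hM' : {b | IsClosedCoset A b ∧ ∃ m ∈ M, m ∩ c ⊆ b} ∈ Good := by
      refine ⟨fun b hb => ⟨hb.1, ?_⟩, fun b hb b' hb' => ?_⟩
      · obtain ⟨-, m, hm, hb⟩ := hb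
        exact (hmc m hm).mono hb
      · obtain ⟨hb, m, hm, hmb⟩ := hb
        obtain ⟨hb', m', hm', hmb'⟩ := hb'
        have hsub : (m ∩ m') ∩ c ⊆ b ∩ b' := fun x hx =>
          ⟨hmb ⟨hx.1.1, hx.2⟩, hmb' ⟨hx.1.2, hx.2⟩⟩
        have hmm := hMgood.2 m hm m' hm'
        exact ⟨hb.inter hb' ((hmc _ hmm).mono hsub), _, hmm, hsub⟩
    have hsub := hM.le_of_ge hM' (fun b hb =>
      ⟨(hMgood.1 b hb).1, b, hb, Set.inter_subset_left⟩)
    obtain ⟨i⟩ := ‹Nonempty ι›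
    exact hsub ⟨hc, s i, hM₀M ⟨hcc i, i, subset_rfl⟩, Set.inter_subset_right⟩
  have hcoset : ∀ V : Submodule A X, IsOpen (V : Set X) → ∃ x, {y | y - x ∈ V} ∈ M := by
    intro V hV
    have hfin := hX.finite_quotient hV
    have hart : IsArtinian A (X ⧸ V) := isArtinian_of_tower k inferInstance
    let 𝓢 : Set (Submodule A (X ⧸ V)) := {T | ∃ (x : X) (L : Submodule A X),
      IsClosed (L : Set X) ∧ {y | y - x ∈ L} ∈ M ∧ T = L.map V.mkQ}
    have heq : ∀ (s : Set X) (x : X) (L : Submodule A X), (∀ y, y ∈ s ↔ y - x ∈ L) →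
        s = {y | y - x ∈ L} := fun s x L h => Set.ext h
    have h𝓢 : 𝓢.Nonempty := by
      obtain ⟨i⟩ := ‹Nonempty ι›
      obtain ⟨x, L, hL, hs⟩ := hcc i
      exact ⟨_, x, L, hL, heq _ _ _ hs ▸ hM₀M ⟨hcc i, i, subset_rfl⟩, rfl⟩
    obtain ⟨T, ⟨x, L, hL, hxL, rfl⟩, hmin⟩ := WellFounded.has_min
      (wellFounded_lt : WellFounded
        ((· < ·) : Submodule A (X ⧸ V) → Submodule A (X ⧸ V) → Prop)) 𝓢 h𝓢
    refine ⟨x, hadd _ ⟨x, V, isClosed_of_isOpen_submodule hV, fun y => Iff.rfl⟩ fun m hm => ?_⟩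
    have hmm := hMgood.2 m hm _ hxL
    obtain ⟨y, hym, hyx⟩ := (hMgood.1 _ hmm).2
    obtain ⟨w, L', hL', hmw⟩ := (hMgood.1 m hm).1
    have hinter : m ∩ {y | y - x ∈ L} = {z | z - y ∈ L' ⊓ L} := by
      ext z
      rw [Set.mem_inter_iff, hmw, Set.mem_ofPred_eq, Set.mem_ofPred_eq, Submodule.mem_inf]
      have h1 : z - w = (z - y) + (y - w) := by abel
      have h2 : z - x = (z - y) + (y - x) := by abel
      rw [h1, h2, Submodule.add_mem_iff_left _ ((hmw y).1 hym),
        Submodule.add_mem_iff_left _ hyx]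
    have hle : (L' ⊓ L).map V.mkQ ≤ L.map V.mkQ := Submodule.map_mono inf_le_right
    have heqT : (L' ⊓ L).map V.mkQ = L.map V.mkQ := by
      by_contra hne'
      exact hmin _ ⟨y, L' ⊓ L, hL'.inter hL, hinter ▸ hmm, rfl⟩ (lt_of_le_of_ne hle hne')
    have hmem : V.mkQ (x - y) ∈ (L' ⊓ L).map V.mkQ := by
      rw [heqT]
      refine ⟨x - y, ?_, rfl⟩
      have := L.neg_mem hyx
      rwa [neg_sub] at this
    obtain ⟨u, hu, hux⟩ := hmem
    refine ⟨y + u, ?_, ?_⟩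
    · have : y + u ∈ m ∩ {y | y - x ∈ L} := by
        rw [hinter]
        simpa using hu
      exact this.1
    · have := (Submodule.Quotient.eq V).1 hux
      have h3 : y + u - x = u - (x - y) := by abel
      rw [Set.mem_ofPred_eq, h3]
      exact this
  choose x hx using hcoset
  have hmeet : ∀ c ∈ M, ∀ c' ∈ M, (c ∩ c').Nonempty := fun c hc c' hc' =>
    (hMgood.1 _ (hMgood.2 c hc c' hc')).2
  obtain ⟨z, hz⟩ := hX.complete (fun V => V.1.mkQ (x V.1 V.2.1)) (fun V W hVW => by
    have hVW' : V.1 ≤ W.1.comap LinearMap.id := hVW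
    rw [mapQ', dif_pos hVW']
    refine (Submodule.Quotient.eq W.1).2 ?_
    change x V.1 V.2.1 - x W.1 W.2.1 ∈ W.1
    obtain ⟨y, hy1, hy2⟩ := hmeet _ (hx V.1 V.2.1) _ (hx W.1 W.2.1)
    have := sub_mem hy2 (hVW hy1)
    simpa using this)
  refine ⟨z, fun i => ?_⟩
  obtain ⟨w, L, hL, hs⟩ := hcc i
  rw [hs]
  refine hX.mem_of_forall_open hL fun V hV => ?_
  obtain ⟨y, hys, hyV⟩ := hmeet _ (hM₀M ⟨hcc i, i, subset_rfl⟩) _ (hx V hV)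
  have h1 := (Submodule.Quotient.eq V).1 (hz ⟨V, hV, hX.finite_restrictScalars hV⟩)
  have h2 : z - w = (y - w) + -((x V hV - z) + (y - x V hV)) := by abel
  rw [h2]
  exact Submodule.add_mem_sup ((hs y).1 hys) (V.neg_mem (V.add_mem h1 hyV))

end IsPseudocompactMod

end PseudocompactTheory

section PseudocompactConstructions

variable {k : Type} [Field k] {A : Type} [Ring A] [Algebra k A] [TopologicalSpace A]
  {X : Type} [AddCommGroup X] [Module k X] [Module A X] [IsScalarTower k A X]
  [TopologicalSpace X]
  {Y : Type} [AddCommGroup Y] [Module k Y] [Module A Y] [IsScalarTower k A Y]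
  [TopologicalSpace Y]

namespace IsPseudocompactMod

/-- A criterion for pseudocompactness in which completeness is expressed by representatives. -/
lemma of_representatives (t2 : T2Space X) (addGroup : IsTopologicalAddGroup X)
    (contSMul : ContinuousSMul A X)
    (basis : ∀ s ∈ nhds (0 : X), ∃ V : Submodule A X, (V : Set X) ⊆ s ∧ IsOpen (V : Set X) ∧
      FiniteDimensional k (X ⧸ V.restrictScalars k))
    (complete : ∀ a : {V : Submodule A X // IsOpen (V : Set X) ∧
      FiniteDimensional k (X ⧸ V.restrictScalars k)} → X,
      (∀ V W, V.1 ≤ W.1 → a V - a W ∈ W.1) → ∃ x, ∀ V, a V - x ∈ V.1) :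
    IsPseudocompactMod k A X where
  t2 := t2
  addGroup := addGroup
  contSMul := contSMul
  basis := ⟨fun t => ⟨fun ht => by
    obtain ⟨V, hVt, hV⟩ := basis t ht
    exact ⟨V, hV, hVt⟩, fun ⟨V, hV, hVt⟩ => Filter.mem_of_superset
      (hV.1.mem_nhds V.zero_mem) hVt⟩⟩
  inf_bot := by
    rw [eq_bot_iff]
    intro x hx
    by_contra hx0
    obtain ⟨V, hVt, hV⟩ := basis {x}ᶜ (isOpen_compl_singleton.mem_nhds fun h => hx0 h.symm)
    have h1 : x ∈ V := by
      simp only [Submodule.mem_iInf] at hx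
      exact hx V hV
    exact hVt h1 rfl
  complete := by
    intro c hc
    choose a ha using fun V => Submodule.Quotient.mk_surjective _ (c V)
    obtain ⟨x, hx⟩ := complete a fun V W hVW => by
      have h := hc V W hVW
      have hVW' : V.1 ≤ W.1.comap LinearMap.id := hVW
      rw [mapQ', dif_pos hVW', ← ha V, ← ha W] at h
      exact (Submodule.Quotient.eq W.1).1 h
    exact ⟨x, fun V => by rw [← ha V]; exact (Submodule.Quotient.eq V.1).2 (hx V)⟩

lemma exists_limit (hX : IsPseudocompactMod k A X)
    (a : {V : Submodule A X // IsOpen (V : Set X) ∧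
      FiniteDimensional k (X ⧸ V.restrictScalars k)} → X)
    (ha : ∀ V W, V.1 ≤ W.1 → a V - a W ∈ W.1) : ∃ x, ∀ V, a V - x ∈ V.1 := by
  obtain ⟨x, hx⟩ := hX.complete (fun V => Submodule.Quotient.mk (a V)) fun V W hVW => by
    have hVW' : V.1 ≤ W.1.comap LinearMap.id := hVW
    rw [mapQ', dif_pos hVW']
    exact (Submodule.Quotient.eq W.1).2 (ha V W hVW)
  exact ⟨x, fun V => (Submodule.Quotient.eq V.1).1 (hx V)⟩

lemma prod (hX : IsPseudocompactMod k A X) (hY : IsPseudocompactMod k A Y) :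
    IsPseudocompactMod k A (X × Y) := by
  have := hX.t2
  have := hY.t2
  have := hX.addGroup
  have := hY.addGroup
  have := hX.contSMul
  have := hY.contSMul
  have hprod : ∀ (V : Submodule A X) (W : Submodule A Y), IsOpen (V : Set X) →
      IsOpen (W : Set Y) → IsOpen (V.prod W : Set (X × Y)) ∧
      FiniteDimensional k ((X × Y) ⧸ (V.prod W).restrictScalars k) := by
    intro V W hV hW
    refine ⟨hV.prod hW, ?_⟩
    have := hX.finite_quotient hV
    have := hY.finite_quotient hW
    refine finiteDimensional_quotient_of_ker_le
      (LinearMap.prodMap V.mkQ W.mkQ) (V := V.prod W) ?_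
    rintro ⟨x, y⟩ hxy
    rw [LinearMap.mem_ker, LinearMap.prodMap_apply, Prod.mk_eq_zero] at hxy
    exact ⟨(Submodule.Quotient.mk_eq_zero _).1 hxy.1, (Submodule.Quotient.mk_eq_zero _).1 hxy.2⟩
  have hbasis : ∀ s ∈ nhds (0 : X × Y), ∃ (V : Submodule A X) (W : Submodule A Y),
      IsOpen (V : Set X) ∧ IsOpen (W : Set Y) ∧ (V.prod W : Set (X × Y)) ⊆ s := by
    intro s hs
    rw [show (0 : X × Y) = ((0 : X), (0 : Y)) from rfl, nhds_prod_eq, Filter.mem_prod_iff] at hs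
    obtain ⟨u, hu, v, hv, huv⟩ := hs
    obtain ⟨V, hV, hVu⟩ := hX.basis.mem_iff.1 hu
    obtain ⟨W, hW, hWv⟩ := hY.basis.mem_iff.1 hv
    exact ⟨V, W, hV.1, hW.1, (Set.prod_mono hVu hWv).trans huv⟩
  refine of_representatives inferInstance inferInstance inferInstance ?_ ?_
  · intro s hs
    obtain ⟨V, W, hV, hW, hVW⟩ := hbasis s hs
    exact ⟨V.prod W, hVW, hprod V W hV hW⟩
  · intro a ha
    obtain ⟨x, hx⟩ := hX.exists_limit (fun V => (a ⟨V.1.prod ⊤, hprod _ _ V.2.1 isOpen_univ⟩).1)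
      fun V W hVW => (ha ⟨V.1.prod ⊤, hprod _ _ V.2.1 isOpen_univ⟩
        ⟨W.1.prod ⊤, hprod _ _ W.2.1 isOpen_univ⟩ (Submodule.prod_mono hVW le_rfl)).1
    obtain ⟨y, hy⟩ := hY.exists_limit
      (fun V => (a ⟨Submodule.prod ⊤ V.1, hprod _ _ isOpen_univ V.2.1⟩).2)
      fun V W hVW => (ha ⟨Submodule.prod ⊤ V.1, hprod _ _ isOpen_univ V.2.1⟩
        ⟨Submodule.prod ⊤ W.1, hprod _ _ isOpen_univ W.2.1⟩ (Submodule.prod_mono le_rfl hVW)).2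
    refine ⟨(x, y), fun U => ?_⟩
    obtain ⟨V, W, hV, hW, hVW⟩ := hbasis _ (U.2.1.mem_nhds U.1.zero_mem)
    have h0 := ha ⟨V.prod W, hprod V W hV hW⟩ U hVW
    have h1 := (ha ⟨V.prod W, hprod V W hV hW⟩ ⟨V.prod ⊤, hprod _ _ hV isOpen_univ⟩
      (Submodule.prod_mono le_rfl le_top)).1
    have h2 := (ha ⟨V.prod W, hprod V W hV hW⟩ ⟨Submodule.prod ⊤ W, hprod _ _ isOpen_univ hW⟩
      (Submodule.prod_mono le_top le_rfl)).2
    have h3 := hx ⟨V, hV, hX.finite_restrictScalars hV⟩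
    have h4 := hy ⟨W, hW, hY.finite_restrictScalars hW⟩
    have h5 : a ⟨V.prod W, hprod V W hV hW⟩ - (x, y) ∈ V.prod W := by
      constructor
      · have := V.add_mem h1 h3
        simpa using this
      · have := W.add_mem h2 h4
        simpa using this
    have h6 := U.1.sub_mem (hVW h5) h0
    simpa using h6

lemma submodule (hX : IsPseudocompactMod k A X) {L : Submodule A X}
    (hL : IsClosed (L : Set X)) : IsPseudocompactMod k A L := by
  have := hX.t2
  have := hX.addGroup
  have := hX.contSMul
  have haddL : IsTopologicalAddGroup L := inferInstanceAs (IsTopologicalAddGroup L.toAddSubgroup)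
  have hbasis : ∀ s ∈ nhds (0 : L), ∃ V : Submodule A L, (V : Set L) ⊆ s ∧
      IsOpen (V : Set L) ∧ FiniteDimensional k (L ⧸ V.restrictScalars k) := by
    intro s hs
    rw [nhds_subtype_eq_comap, Filter.mem_comap] at hs
    obtain ⟨t, ht, hts⟩ := hs
    obtain ⟨V, hV, hVt⟩ := hX.basis.mem_iff.1 ht
    refine ⟨V.comap L.subtype, fun x hx => hts (hVt hx), hV.1.preimage continuous_subtype_val, ?_⟩
    have := hX.finite_quotient hV.1
    refine finiteDimensional_quotient_of_ker_le (V.mkQ.comp L.subtype)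
      (V := V.comap L.subtype) ?_
    intro x hx
    exact (Submodule.Quotient.mk_eq_zero V).1 hx
  refine of_representatives inferInstance haddL
    inferInstance hbasis ?_
  intro a ha
  obtain ⟨V₀, -, hV₀⟩ := hbasis Set.univ Filter.univ_mem
  have : Nonempty {V : Submodule A L // IsOpen (V : Set L) ∧
      FiniteDimensional k (L ⧸ V.restrictScalars k)} := ⟨⟨V₀, hV₀⟩⟩
  obtain ⟨x, hx⟩ := hX.exists_mem_cosets
    (fun V : {V : Submodule A L // IsOpen (V : Set L) ∧
      FiniteDimensional k (L ⧸ V.restrictScalars k)} =>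
        {y : X | y - (a V : X) ∈ V.1.map L.subtype})
    (fun V => ⟨a V, V.1.map L.subtype, by
      rw [Submodule.map_coe]
      exact hL.isClosedEmbedding_subtypeVal.isClosedMap _
        (isClosed_of_isOpen_submodule V.2.1), fun y => Iff.rfl⟩)
    (fun V => ⟨a V, by
      rw [Set.mem_ofPred_eq, sub_self]
      exact zero_mem _⟩)
    (fun V W => by
      obtain ⟨U, hU, hU'⟩ := hbasis ((V.1 : Set L) ∩ W.1)
        ((V.2.1.inter W.2.1).mem_nhds ⟨V.1.zero_mem, W.1.zero_mem⟩)
      have key : ∀ T : {V : Submodule A L // IsOpen (V : Set L) ∧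
          FiniteDimensional k (L ⧸ V.restrictScalars k)}, U ≤ T.1 → ∀ y : X,
          y - (a ⟨U, hU'⟩ : X) ∈ U.map L.subtype → y - (a T : X) ∈ T.1.map L.subtype := by
        intro T hT y hy
        have h1 : y - (a T : X) = (y - (a ⟨U, hU'⟩ : X)) + L.subtype (a ⟨U, hU'⟩ - a T) := by
          simp
        rw [h1]
        exact add_mem (Submodule.map_mono hT hy)
          (Submodule.mem_map_of_mem (ha ⟨U, hU'⟩ T hT))
      exact ⟨⟨U, hU'⟩, fun y hy => key V (fun z hz => (hU hz).1) y hy,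
        fun y hy => key W (fun z hz => (hU hz).2) y hy⟩)
  have hxL : x ∈ L := by
    obtain ⟨y, -, hy⟩ := hx ⟨V₀, hV₀⟩
    have := L.add_mem y.2 (a ⟨V₀, hV₀⟩).2
    change L.subtype y + _ ∈ L at this
    rw [hy] at this
    simpa using this
  refine ⟨⟨x, hxL⟩, fun V => ?_⟩
  obtain ⟨y, hyV, hy⟩ := hx V
  have : a V - ⟨x, hxL⟩ = -y := by
    ext
    change (a V : X) - x = -L.subtype y
    rw [hy]
    abel
  rw [this]
  exact V.1.neg_mem hyV

lemma isClosed_map (hX : IsPseudocompactMod k A X) (hY : IsPseudocompactMod k A Y)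
    {q : X →ₗ[A] Y} (hq : Continuous q) {L : Submodule A X} (hL : IsClosed (L : Set X)) :
    IsClosed (L.map q : Set Y) := by
  have := hY.t2
  have := hY.addGroup
  refine isClosed_of_closure_subset fun y hy => ?_
  have hne : ∀ V : Submodule A Y, IsOpen (V : Set Y) → ∃ x ∈ L, q x - y ∈ V := by
    intro V hV
    have hn : {z | z - y ∈ V} ∈ nhds y :=
      (hV.preimage (continuous_id.sub continuous_const)).mem_nhds (by simp)
    obtain ⟨z, hz, x, hx, rfl⟩ := mem_closure_iff_nhds.1 hy _ hn
    exact ⟨x, hx, hz⟩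
  have : Nonempty {V : Submodule A Y // IsOpen (V : Set Y)} := ⟨⟨⊤, isOpen_univ⟩⟩
  obtain ⟨x, hx⟩ := hX.exists_mem_cosets
    (fun V : {V : Submodule A Y // IsOpen (V : Set Y)} => {x | x ∈ L ∧ q x - y ∈ V.1})
    (fun V => by
      obtain ⟨x, hx, hxV⟩ := hne V.1 V.2
      refine ⟨x, L ⊓ V.1.comap q, hL.inter
        ((isClosed_of_isOpen_submodule V.2).preimage hq), fun z => ?_⟩
      have h1 : q z - y = q (z - x) + (q x - y) := by rw [map_sub]; abel
      rw [Set.mem_ofPred_eq, h1, V.1.add_mem_iff_left hxV, Submodule.mem_inf,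
        Submodule.mem_comap, L.sub_mem_iff_left hx])
    (fun V => hne V.1 V.2)
    (fun V W => ⟨⟨V.1 ⊓ W.1, V.2.inter W.2⟩, fun x hx => ⟨hx.1, hx.2.1⟩,
      fun x hx => ⟨hx.1, hx.2.2⟩⟩)
  refine ⟨x, (hx ⟨⊤, isOpen_univ⟩).1, ?_⟩
  have : q x - y ∈ (⊥ : Submodule A Y) := by
    refine hY.mem_of_forall_open (by simp) fun V hV => ?_
    rw [bot_sup_eq]
    exact (hx ⟨V, hV⟩).2
  exact sub_eq_zero.1 ((Submodule.mem_bot A).1 this)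

lemma exists_minimal_supplement (hX : IsPseudocompactMod k A X) {W Q : Submodule A X}
    (hW : IsClosed (W : Set X)) (hQ : IsClosed (Q : Set X)) (h : W ⊔ Q = ⊤) :
    ∃ L ≤ W, IsClosed (L : Set X) ∧ L ⊔ Q = ⊤ ∧
      ∀ L' ≤ L, IsClosed (L' : Set X) → L' ⊔ Q = ⊤ → L' = L := by
  let 𝓢 : Set (Set X) := {s | ∃ L : Submodule A X, (L : Set X) = s ∧ IsClosed s ∧ L ⊔ Q = ⊤}
  obtain ⟨m, hmW, hm⟩ := zorn_superset_nonempty 𝓢 (fun C hC hchain hCne => by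
    refine ⟨⋂₀ C, ?_, fun s hs => Set.sInter_subset_of_mem hs⟩
    choose! L hL using fun s (hs : s ∈ C) => hC hs
    refine ⟨⨅ s ∈ C, L s, ?_, isClosed_sInter fun s hs => (hL s hs).2.1, ?_⟩
    · ext x
      simp only [SetLike.mem_coe, Submodule.mem_iInf, Set.mem_sInter]
      exact forall₂_congr fun s hs => by rw [← SetLike.mem_coe, (hL s hs).1]
    · rw [eq_top_iff]
      intro x _
      have : Nonempty C := hCne.to_subtype
      have hne : ∀ s ∈ C, ∃ y ∈ L s, x - y ∈ Q := by
        intro s hs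
        obtain ⟨y, hy, z, hz, hyz⟩ := Submodule.mem_sup.1
          ((hL s hs).2.2 ▸ Submodule.mem_top : x ∈ L s ⊔ Q)
        exact ⟨y, hy, by rw [← hyz]; simpa using hz⟩
      obtain ⟨y, hy⟩ := hX.exists_mem_cosets (fun s : C => {y | y ∈ L s ∧ x - y ∈ Q})
        (fun s => by
          obtain ⟨y, hy, hyQ⟩ := hne s s.2
          have hcl : IsClosed (L s : Set X) := by
            rw [(hL s s.2).1]
            exact (hL s s.2).2.1
          refine ⟨y, L s ⊓ Q, hcl.inter hQ, fun z => ?_⟩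
          have h1 : x - z = (x - y) - (z - y) := by abel
          rw [Set.mem_ofPred_eq, h1, Q.sub_mem_iff_right hyQ, Submodule.mem_inf,
            (L s).sub_mem_iff_left hy])
        (fun s => hne s s.2)
        (fun s t => by
          have hmono : ∀ s t : C, (s : Set X) ⊆ t → L s ≤ L t := by
            intro s t hst x hx
            rw [← SetLike.mem_coe, (hL t t.2).1]
            apply hst
            rw [← (hL s s.2).1]
            exact hx
          rcases hchain.total s.2 t.2 with hst | hst
          · exact ⟨s, subset_rfl, fun y hy => ⟨hmono s t hst hy.1, hy.2⟩⟩
          · exact ⟨t, fun y hy => ⟨hmono t s hst hy.1, hy.2⟩, subset_rfl⟩)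
      have hyL : y ∈ ⨅ s ∈ C, L s := by
        simp only [Submodule.mem_iInf]
        exact fun s hs => (hy ⟨s, hs⟩).1
      obtain ⟨s₀, hs₀⟩ := hCne
      exact Submodule.mem_sup.2 ⟨y, hyL, x - y, (hy ⟨s₀, hs₀⟩).2, by abel⟩)
    (W : Set X) ⟨W, rfl, hW, h⟩
  obtain ⟨L, rfl, hLc, hLQ⟩ := hm.prop
  refine ⟨L, hmW, hLc, hLQ, fun L' hL' hL'c hL'Q => le_antisymm hL' ?_⟩
  exact hm.le_of_le ⟨L', rfl, hL'c, hL'Q⟩ hL'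

end IsPseudocompactMod

end PseudocompactConstructions

section Locality

variable {k : Type} [Field k] {G : Type} [Group G] [TopologicalSpace G]
  {P : Type} [AddCommGroup P] [Module k P] [Module (CGA k G) P]
  [IsScalarTower k (CGA k G) P] [TopologicalSpace P]

/-- Supplements in a projective pseudocompact module: a proper open maximal submodule of an
indecomposable projective contains every proper closed submodule. -/
lemma IsPseudocompactMod.eq_top_of_sup_eq_top (hP : IsPseudocompactMod k (CGA k G) P)
    (hproj : IsPCProjective k G P) (hind : IsIndecTop (CGA k G) P)
    {W Q : Submodule (CGA k G) P} (hW : IsClosed (W : Set P)) (hQ : IsClosed (Q : Set P))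
    (hQtop : Q ≠ ⊤) (h : W ⊔ Q = ⊤) : W = ⊤ := by
  have := hP.t2
  have := hP.addGroup
  obtain ⟨L, hLW, hLc, hLQ, hLmin⟩ := hP.exists_minimal_supplement hW hQ h
  obtain ⟨F, hFQ, hFc, hFL, hFmin⟩ := hP.exists_minimal_supplement hQ hLc
    (by rw [sup_comm]; exact hLQ)
  have hFLpc := (hP.submodule hFc).prod (hP.submodule hLc)
  obtain ⟨s, hs, hsid⟩ := hproj (F × L) hFLpc (F.subtype.coprod L.subtype)
    ((continuous_subtype_val.comp continuous_fst).add
      (continuous_subtype_val.comp continuous_snd)) (by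
      intro x
      obtain ⟨f, hf, l, hl, hx⟩ := Submodule.mem_sup.1 (hFL ▸ Submodule.mem_top : x ∈ F ⊔ L)
      exact ⟨(⟨f, hf⟩, ⟨l, hl⟩), hx⟩)
  let q : P →ₗ[CGA k G] P := L.subtype.comp ((LinearMap.snd _ F L).comp s)
  let r : P →ₗ[CGA k G] P := F.subtype.comp ((LinearMap.fst _ F L).comp s)
  have hqc : Continuous q := continuous_subtype_val.comp (continuous_snd.comp hs)
  have hrc : Continuous r := continuous_subtype_val.comp (continuous_fst.comp hs)
  have hrq : ∀ x, r x + q x = x := fun x => LinearMap.congr_fun hsid x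
  have hq : ∀ x, q x ∈ L := fun x => (s x).2.2
  have hr : ∀ x, r x ∈ F := fun x => (s x).1.2
  have hker : ∀ f : P →ₗ[CGA k G] P, Continuous f → IsClosed (LinearMap.ker f : Set P) :=
    fun f hf => isClosed_singleton.preimage hf
  have hqL : L.map q = L := by
    refine hLmin _ (Submodule.map_le_iff_le_comap.2 fun x _ => hq x)
      (hP.isClosed_map hP hqc hLc) ?_
    rw [eq_top_iff, ← hLQ]
    refine sup_le (fun x hx => ?_) le_sup_right
    rw [← hrq x]
    exact add_mem (Submodule.mem_sup_right (hFQ (hr x)))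
      (Submodule.mem_sup_left (Submodule.mem_map_of_mem hx))
  have hkq : LinearMap.ker q = F := by
    refine hFmin _ (fun x hx => ?_) (hker q hqc) ?_
    · have h1 := hrq x
      rw [LinearMap.mem_ker.1 hx, add_zero] at h1
      rw [← h1]
      exact hr x
    · rw [eq_top_iff]
      intro x _
      obtain ⟨l, hl, hlx⟩ := hqL.symm ▸ hq x
      refine Submodule.mem_sup.2 ⟨x - l, ?_, l, hl, by abel⟩
      rw [LinearMap.mem_ker, map_sub, hlx, sub_self]
  have hrF : ∀ x ∈ F, r x = x := by
    intro x hx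
    rw [← hkq, LinearMap.mem_ker] at hx
    simpa [hx] using hrq x
  have hsup : LinearMap.ker r ⊔ F = ⊤ := by
    rw [eq_top_iff]
    intro x _
    refine Submodule.mem_sup.2 ⟨x - r x, ?_, r x, hr x, by abel⟩
    rw [LinearMap.mem_ker, map_sub, hrF _ (hr x), sub_self]
  have hkr : LinearMap.ker r = L := by
    refine hLmin _ (fun x hx => ?_) (hker r hrc) ?_
    · have h1 := hrq x
      rw [LinearMap.mem_ker.1 hx, zero_add] at h1
      rw [← h1]
      exact hq x
    · rw [eq_top_iff, ← hsup]
      exact sup_le_sup_left hFQ _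
  have hcompl : IsCompl L F := by
    constructor
    · rw [disjoint_iff, eq_bot_iff]
      rintro x ⟨hxL, hxF⟩
      rw [SetLike.mem_coe, ← hkr, LinearMap.mem_ker, hrF x hxF] at hxL
      exact (Submodule.mem_bot _).2 hxL
    · rw [codisjoint_iff, sup_comm]
      exact hFL
  rcases hind.2 L F hLc hFc hcompl with h0 | h0
  · rw [h0, bot_sup_eq] at hLQ
    exact absurd hLQ hQtop
  · rw [h0, bot_sup_eq] at hFL
    rw [hFL] at hLW
    exact top_le_iff.1 hLW

lemma IsPseudocompactMod.exists_greatest_open (hP : IsPseudocompactMod k (CGA k G) P)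
    (hproj : IsPCProjective k G P) (hind : IsIndecTop (CGA k G) P) :
    ∃ Q : Submodule (CGA k G) P, IsOpen (Q : Set P) ∧ Q ≠ ⊤ ∧
      ∀ W : Submodule (CGA k G) P, IsClosed (W : Set P) → W ≠ ⊤ → W ≤ Q := by
  have := hP.addGroup
  obtain ⟨V, hV, hVtop⟩ : ∃ V : Submodule (CGA k G) P, IsOpen (V : Set P) ∧ V ≠ ⊤ := by
    by_contra! hcon
    have := hind.1
    obtain ⟨x, hx⟩ := exists_ne (0 : P)
    have h1 : x ∈ (⊥ : Submodule (CGA k G) P) := by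
      rw [← hP.inf_bot]
      simp only [Submodule.mem_iInf]
      intro V hV
      rw [hcon V hV.1]
      exact Submodule.mem_top
    exact hx ((Submodule.mem_bot _).1 h1)
  have hfin := hP.finite_quotient hV
  have : IsNoetherian (CGA k G) (P ⧸ V) := isNoetherian_of_tower k inferInstance
  have : Nontrivial (P ⧸ V) := Submodule.Quotient.nontrivial_iff.2 hVtop
  obtain ⟨T, hT⟩ := (eq_top_or_exists_le_coatom (⊥ : Submodule (CGA k G) (P ⧸ V))).resolve_left
    bot_ne_top
  have hQ : IsCoatom (T.comap V.mkQ) :=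
    (Submodule.isCoatom_comap_iff V.mkQ_surjective).2 hT.1
  have hVQ : V ≤ T.comap V.mkQ := Submodule.le_comap_mkQ V T
  have hQo := isOpen_of_le hVQ hV
  refine ⟨_, hQo, hQ.1, fun W hW hWtop => ?_⟩
  by_contra hle
  exact hWtop (hP.eq_top_of_sup_eq_top hproj hind hW (isClosed_of_isOpen_submodule hQo) hQ.1
    (by rw [sup_comm]; exact hQ.2 _ (left_lt_sup.2 hle)))

end Locality

section CompletedGroupAlgebra

variable {k : Type} [Field k] {G : Type} [Group G] [TopologicalSpace G]

variable (k) in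
/-- The projection `k⟦G⟧ → k[G/N]` as an algebra homomorphism. -/
def projHom (N : OpenNormalSubgroup G) :
    CGA k G →ₐ[k] MonoidAlgebra k (G ⧸ N.toSubgroup) :=
  (Pi.evalAlgHom k (fun N : OpenNormalSubgroup G => MonoidAlgebra k (G ⧸ N.toSubgroup)) N).comp
    (CGA k G).val

lemma projHom_ofG (N : OpenNormalSubgroup G) (g : G) :
    projHom k N (ofG k G g) = MonoidAlgebra.single (g : G ⧸ N.toSubgroup) 1 := rfl

lemma exists_mem_span_projHom_eq (N : OpenNormalSubgroup G)
    (y : MonoidAlgebra k (G ⧸ N.toSubgroup)) :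
    ∃ b ∈ Submodule.span k (Set.range (ofG k G)), projHom k N b = y := by
  induction y using MonoidAlgebra.induction_on with
  | of g =>
    obtain ⟨g, rfl⟩ := QuotientGroup.mk_surjective g
    exact ⟨ofG k G g, Submodule.subset_span ⟨g, rfl⟩, projHom_ofG N g⟩
  | add x y hx hy =>
    obtain ⟨a, ha, rfl⟩ := hx
    obtain ⟨b, hb, rfl⟩ := hy
    exact ⟨a + b, add_mem ha hb, map_add _ _ _⟩
  | smul c x hx =>
    obtain ⟨a, ha, rfl⟩ := hx
    exact ⟨c • a, Submodule.smul_mem _ c ha, map_smul _ _ _⟩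

lemma projHom_surjective (N : OpenNormalSubgroup G) : Function.Surjective (projHom k N) :=
  fun y => by
    obtain ⟨b, -, hb⟩ := exists_mem_span_projHom_eq N y
    exact ⟨b, hb⟩

lemma projHom_eq_zero_of_le {N M : OpenNormalSubgroup G} (h : N ≤ M) {a : CGA k G}
    (ha : projHom k N a = 0) : projHom k M a = 0 := by
  have h1 := a.2 N M h
  change tHom k G N M h (projHom k N a) = projHom k M a at h1
  rw [← h1, ha, map_zero]

lemma exists_projHom_eq_zero_subset {s : Set (CGA k G)} (hs : s ∈ nhds (0 : CGA k G)) :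
    ∃ M : OpenNormalSubgroup G, ∀ a, projHom k M a = 0 → a ∈ s := by
  obtain ⟨u, hus, ⟨t, ht, rfl⟩, hu0⟩ := mem_nhds_iff.1 hs
  obtain ⟨I, v, hv, hIv⟩ := isOpen_pi_iff.1 ht _ hu0
  have hM : ∃ M : OpenNormalSubgroup G, ∀ i ∈ I, M ≤ i := by
    clear hv hIv
    induction I using Finset.induction_on with
    | empty =>
      have h1 : IsOpen ((⊤ : Subgroup G) : Set G) := isOpen_univ
      exact ⟨⟨⟨⊤, h1⟩, inferInstanceAs (⊤ : Subgroup G).Normal⟩, by simp⟩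
    | insert i I _ ih =>
      obtain ⟨M, hM⟩ := ih
      refine ⟨M ⊓ i, fun j hj => ?_⟩
      rcases Finset.mem_insert.1 hj with rfl | hj
      · exact inf_le_right
      · exact inf_le_left.trans (hM j hj)
  obtain ⟨M, hM⟩ := hM
  refine ⟨M, fun a ha => hus (hIv fun i hi => ?_)⟩
  have h1 : (a : ∀ N : OpenNormalSubgroup G, MonoidAlgebra k (G ⧸ N.toSubgroup)) i = 0 :=
    projHom_eq_zero_of_le (hM i hi) ha
  rw [h1]
  exact (hv i hi).2

variable {P : Type} [AddCommGroup P] [Module k P] [Module (CGA k G) P]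
  [IsScalarTower k (CGA k G) P] [TopologicalSpace P]

lemma IsPseudocompactMod.exists_smul_mem_of_projHom_eq_zero
    (hP : IsPseudocompactMod k (CGA k G) P) {V : Submodule (CGA k G) P}
    (hV : IsOpen (V : Set P)) :
    ∃ M : OpenNormalSubgroup G, ∀ a, projHom k M a = 0 → ∀ x : P, a • x ∈ V := by
  have := hP.contSMul
  have := hP.finite_restrictScalars hV
  obtain ⟨n, s, hs⟩ := Module.Finite.exists_fin (R := k) (M := P ⧸ V.restrictScalars k)
  choose x hx using fun i => (V.restrictScalars k).mkQ_surjective (s i)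
  have hopen : {a : CGA k G | ∀ i, a • x i ∈ V} ∈ nhds (0 : CGA k G) := by
    have h1 : {a : CGA k G | ∀ i, a • x i ∈ V} = ⋂ i, (fun a : CGA k G => a • x i) ⁻¹' V := by
      ext a
      simp
    rw [h1, Filter.iInter_mem]
    intro i
    refine (hV.preimage (continuous_id.smul continuous_const)).mem_nhds ?_
    simp
  obtain ⟨M, hM⟩ := exists_projHom_eq_zero_subset hopen
  refine ⟨M, fun a ha y => ?_⟩
  let T : Submodule k P := (V.restrictScalars k).comap (Algebra.lsmul k k P a)
  have hT : Submodule.span k (Set.range s) ≤ T.map (V.restrictScalars k).mkQ := by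
    rw [Submodule.span_le]
    rintro _ ⟨i, rfl⟩
    exact ⟨x i, hM a ha i, hx i⟩
  rw [hs] at hT
  obtain ⟨t, ht, hty⟩ := hT (Submodule.mem_top (x := (V.restrictScalars k).mkQ y))
  have h2 : t - y ∈ V := (Submodule.Quotient.eq (V.restrictScalars k)).1 hty
  have h3 : a • t ∈ V := ht
  have h4 := V.sub_mem h3 (V.smul_mem a h2)
  rw [smul_sub] at h4
  simpa using h4

end CompletedGroupAlgebra

section ZpSubgroup

variable {G : Type} [Group G] [TopologicalSpace G] [IsTopologicalGroup G] {p : ℕ} [Fact p.Prime]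
  {D : Subgroup G}

/-- A subgroup isomorphic to `ℤ_p` has a topological generator of infinite order whose
`p`-power powers tend to the identity. -/
lemma IsZpGroup.exists_generator (h : IsZpGroup G p D) :
    ∃ d : G, (∀ M : OpenNormalSubgroup G, D.map (QuotientGroup.mk' M.toSubgroup) =
        Subgroup.zpowers (d : G ⧸ M.toSubgroup)) ∧
      (∀ M : OpenNormalSubgroup G, ∃ r, d ^ p ^ r ∈ M.toSubgroup) ∧
      ∀ r, d ^ p ^ r ≠ 1 := by
  obtain ⟨φ, hφ⟩ := h
  let Φ : D ≃* Multiplicative ℤ_[p] := { φ.toEquiv with map_mul' := hφ }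
  let d : D := Φ.symm (Multiplicative.ofAdd 1)
  have hΦd : ∀ n : ℕ, Φ.symm (Multiplicative.ofAdd (n : ℤ_[p])) = d ^ n := by
    intro n
    rw [← map_pow, ← ofAdd_nsmul, nsmul_one]
  have hcont : Continuous fun z : ℤ_[p] => ((Φ.symm (Multiplicative.ofAdd z) : D) : G) :=
    continuous_subtype_val.comp (φ.symm.continuous.comp continuous_ofAdd)
  refine ⟨d, fun M => le_antisymm ?_ ?_, fun M => ?_, fun r hr => ?_⟩
  · rintro _ ⟨x, hx, rfl⟩
    have hopen : IsOpen {z : ℤ_[p] | x⁻¹ * (Φ.symm (Multiplicative.ofAdd z) : D) ∈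
        (M.toSubgroup : Set G)} :=
      M.isOpen'.preimage (continuous_const.mul hcont)
    obtain ⟨n, hn⟩ := PadicInt.denseRange_natCast.exists_mem_open hopen
      ⟨Multiplicative.toAdd (Φ ⟨x, hx⟩), by
        rw [Set.mem_ofPred_eq, ofAdd_toAdd, MulEquiv.symm_apply_apply]
        simp⟩
    rw [Set.mem_ofPred_eq, hΦd] at hn
    have h1 : ((x : G) : G ⧸ M.toSubgroup) = ((d ^ n : D) : G) := QuotientGroup.eq.2 hn
    exact Subgroup.mem_zpowers_iff.2 ⟨n, by
      rw [QuotientGroup.mk'_apply, h1]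
      simp⟩
  · rw [Subgroup.zpowers_le]
    exact ⟨d, d.2, rfl⟩
  · have hlim : Filter.Tendsto (fun n : ℕ => (p : ℤ_[p]) ^ n) Filter.atTop (nhds 0) :=
      tendsto_pow_atTop_nhds_zero_of_norm_lt_one (by
        rw [PadicInt.norm_p]
        exact inv_lt_one_of_one_lt₀ (by exact_mod_cast (Fact.out : p.Prime).one_lt))
    have h0 : {z : ℤ_[p] | ((Φ.symm (Multiplicative.ofAdd z) : D) : G) ∈
        (M.toSubgroup : Set G)} ∈ nhds (0 : ℤ_[p]) :=
      (M.isOpen'.preimage hcont).mem_nhds (by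
        rw [Set.mem_preimage, ofAdd_zero, map_one]
        exact M.toSubgroup.one_mem)
    obtain ⟨r, hr⟩ := (hlim.eventually h0).exists
    refine ⟨r, ?_⟩
    have h1 := hΦd (p ^ r)
    rw [Nat.cast_pow] at h1
    rw [h1] at hr
    exact_mod_cast hr
  · have h1 : d ^ p ^ r = 1 := by exact_mod_cast hr
    rw [← hΦd, map_eq_one_iff _ Φ.symm.injective, ofAdd_eq_one] at h1
    have h2 : p ^ r = 0 := by exact_mod_cast h1
    exact pow_ne_zero r (Fact.out : p.Prime).ne_zero h2

end ZpSubgroup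

section Transport

variable {R S : Type} [Ring R] [Ring S] {X : Type} [AddCommGroup X] [Module R X] [Module S X]

/-- Along a surjective ring homomorphism, every submodule is stable under the target. -/
def descendSubmodule (f : R →+* S) (hf : Function.Surjective f)
    (h : ∀ (c : R) (x : X), f c • x = c • x) (W : Submodule R X) : Submodule S X :=
  { W.toAddSubmonoid with
    smul_mem' := fun s x hx => by
      obtain ⟨c, rfl⟩ := hf s
      rw [h]
      exact W.smul_mem c hx }

/-- Along a ring homomorphism, every submodule over the target is a submodule over the source. -/
def pullSubmodule (f : R →+* S) (h : ∀ (c : R) (x : X), f c • x = c • x)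
    (W : Submodule S X) : Submodule R X :=
  { W.toAddSubmonoid with
    smul_mem' := fun c x hx => by
      rw [← h]
      exact W.smul_mem (f c) hx }

lemma Uniserial.of_surjective_ringHom (f : R →+* S) (hf : Function.Surjective f)
    (h : ∀ (c : R) (x : X), f c • x = c • x) (hX : Uniserial S X) : Uniserial R X :=
  fun W W' => hX (descendSubmodule f hf h W) (descendSubmodule f hf h W')

lemma IsLocalMod.of_surjective_ringHom (f : R →+* S) (hf : Function.Surjective f)
    (h : ∀ (c : R) (x : X), f c • x = c • x) (hX : IsLocalMod R X) : IsLocalMod S X := by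
  obtain ⟨U, hU, hmax⟩ := hX
  refine ⟨descendSubmodule f hf h U, fun htop => hU ?_, fun W hW => ?_⟩
  · rw [eq_top_iff]
    intro x _
    have h1 : x ∈ descendSubmodule f hf h U := htop ▸ Submodule.mem_top
    exact h1
  · refine hmax (pullSubmodule f h W) fun htop => hW ?_
    rw [eq_top_iff]
    intro x _
    have h1 : x ∈ pullSubmodule f h W := htop ▸ Submodule.mem_top
    exact h1

end Transport

section OpenQuotients

variable {k : Type} [Field k] {G : Type} [Group G] [TopologicalSpace G]

lemma TrivOnSimples.projHom {e : CGA k G} {N M : OpenNormalSubgroup G}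
    (h : TrivOnSimples k G e N) (S : Type) [AddCommGroup S]
    [Module (MonoidAlgebra k (G ⧸ M.toSubgroup)) S]
    (hS : IsSimpleModule (MonoidAlgebra k (G ⧸ M.toSubgroup)) S)
    (he : ∀ v : S, projN k G M e • v = v) :
    ∀ ν ∈ N.toSubgroup.map (QuotientGroup.mk' M.toSubgroup), ∀ v : S,
      MonoidAlgebra.single ν (1 : k) • v = v := by
  let f : CGA k G →+* MonoidAlgebra k (G ⧸ M.toSubgroup) :=
    (ProfiniteBlocks.projHom k M).toRingHom
  have hf : Function.Surjective f := projHom_surjective M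
  letI : Module (CGA k G) S := Module.compHom S f
  haveI : RingHomSurjective f := ⟨hf⟩
  let l : S →ₛₗ[f] S :=
    { toFun := id
      map_add' := fun _ _ => rfl
      map_smul' := fun _ _ => rfl }
  have hS' : IsSimpleModule (CGA k G) S :=
    (LinearMap.isSimpleModule_iff_of_bijective l Function.bijective_id).2 hS
  rintro _ ⟨n, hn, rfl⟩ v
  exact h S hS' (fun v => he v) n hn v

variable {P : Type} [AddCommGroup P] [Module k P] [Module (CGA k G) P]
  [IsScalarTower k (CGA k G) P] [TopologicalSpace P]

lemma isLocalMod_quotient [IsTopologicalAddGroup P] {Q V : Submodule (CGA k G) P}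
    (hQtop : Q ≠ ⊤) (hQ : ∀ W : Submodule (CGA k G) P, IsClosed (W : Set P) → W ≠ ⊤ → W ≤ Q)
    (hV : IsOpen (V : Set P)) (hVtop : V ≠ ⊤) : IsLocalMod (CGA k G) (P ⧸ V) := by
  have hVQ : V ≤ Q := hQ V (isClosed_of_isOpen_submodule hV) hVtop
  have hcomap : ∀ W : Submodule (CGA k G) (P ⧸ V), (W.comap V.mkQ).map V.mkQ = W := fun W =>
    Submodule.map_comap_eq_of_surjective V.mkQ_surjective W
  refine ⟨Q.map V.mkQ, fun htop => hQtop ?_, fun W hW => ?_⟩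
  · have h1 := Submodule.comap_map_mkQ V Q
    rw [htop, Submodule.comap_top, sup_eq_right.2 hVQ] at h1
    exact h1.symm
  · rw [← hcomap W]
    refine Submodule.map_mono (hQ _ (isClosed_of_isOpen_submodule
      (isOpen_of_le (Submodule.le_comap_mkQ V W) hV)) fun htop => hW ?_)
    rw [← hcomap W, htop, Submodule.map_top, Submodule.range_mkQ]

lemma uniserial_openQuotient {p : ℕ} [Fact p.Prime] [CharP k p] [IsTopologicalGroup G]
    [CompactSpace G] [TotallyDisconnectedSpace G] [T2Space G]
    {e : CGA k G} {D : Subgroup G} (hZp : IsZpGroup G p D)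
    {𝒩 : Set (OpenNormalSubgroup G)} (hcof : IsCofinal 𝒩) (hgood : ∀ N ∈ 𝒩, GoodN k G e D N)
    (hP : IsPseudocompactMod k (CGA k G) P) (hPe : InBlock (CGA k G) (X := P) e)
    {Q : Submodule (CGA k G) P} (hQtop : Q ≠ ⊤)
    (hQ : ∀ W : Submodule (CGA k G) P, IsClosed (W : Set P) → W ≠ ⊤ → W ≤ Q)
    {V : Submodule (CGA k G) P} (hV : IsOpen (V : Set P)) : Uniserial (CGA k G) (P ⧸ V) := by
  have := hP.addGroup
  by_cases hVtop : V = ⊤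
  · subst hVtop
    exact fun W W' => Or.inl fun x _ => by
      rw [Subsingleton.elim x 0]
      exact W'.zero_mem
  have hfin := hP.finite_quotient hV
  obtain ⟨M₀, hM₀⟩ := hP.exists_smul_mem_of_projHom_eq_zero hV
  obtain ⟨N, hN, -⟩ := hcof M₀
  obtain ⟨d, hd, hdN, hd1⟩ := hZp.exists_generator
  obtain ⟨r, hr⟩ := hdN N
  obtain ⟨M₁, hM₁⟩ := ProfiniteGrp.exist_openNormalSubgroup_sub_open_nhds_of_one
    (isOpen_compl_singleton (x := d ^ p ^ r)) (fun h => hd1 r h.symm)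
  obtain ⟨M, hM, hMle⟩ := hcof (M₀ ⊓ M₁)
  have : Finite (G ⧸ M.toSubgroup) := Subgroup.quotient_finite_of_isOpen _ M.isOpen'
  have hg := hgood M hM
  obtain ⟨x, hx, htr⟩ := hg.defectN.defect
  rw [hd M] at hx htr
  obtain ⟨s, hs⟩ := hdN M
  obtain ⟨m, -, hm⟩ := (Nat.dvd_prime_pow (Fact.out : p.Prime)).1
    (orderOf_dvd_of_pow_eq_one (x := (d : G ⧸ M.toSubgroup)) (n := p ^ s) (by
      rw [← QuotientGroup.mk_pow]
      exact (QuotientGroup.eq_one_iff _).2 hs))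
  have hnormal : (N.toSubgroup.map (QuotientGroup.mk' M.toSubgroup)).Normal :=
    Subgroup.Normal.map inferInstance _ (QuotientGroup.mk'_surjective _)
  obtain ⟨n, hdata⟩ := exists_cyclicTraceData (F := k) (p := p) (m := m)
    (N := N.toSubgroup.map (QuotientGroup.mk' M.toSubgroup)) (i := p ^ r)
    hg.blockN.idem (Semigroup.mem_center_iff.1 hg.blockN.central) hg.blockN.ne_zero hx htr hm
    (fun S _ _ hS he => (hgood N hN).triv.projHom S hS he)
    ⟨d ^ p ^ r, hr, rfl⟩ (fun h => by
      rw [← QuotientGroup.mk_pow] at h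
      have h1 := (hMle.trans inf_le_right) ((QuotientGroup.eq_one_iff _).1 h)
      exact hM₁ h1 rfl)
  let f : CGA k G →+* MonoidAlgebra k (G ⧸ M.toSubgroup) := (projHom k M).toRingHom
  have hf : Function.Surjective f := projHom_surjective M
  letI : SMul (MonoidAlgebra k (G ⧸ M.toSubgroup)) (P ⧸ V) :=
    ⟨fun a y => Function.surjInv hf a • y⟩
  have hsmul : ∀ (c : CGA k G) (y : P ⧸ V), f c • y = c • y := by
    intro c y
    obtain ⟨y, rfl⟩ := V.mkQ_surjective y
    have h1 : projHom k M (Function.surjInv hf (f c) - c) = 0 := by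
      rw [map_sub, sub_eq_zero]
      exact Function.surjInv_eq hf (f c)
    have h2 := hM₀ _ (projHom_eq_zero_of_le (hMle.trans inf_le_left) h1) y
    change Function.surjInv hf (f c) • V.mkQ y = c • V.mkQ y
    rw [← sub_eq_zero, ← sub_smul, ← map_smul, Submodule.mkQ_apply]
    exact (Submodule.Quotient.mk_eq_zero V).2 h2
  letI : Module (MonoidAlgebra k (G ⧸ M.toSubgroup)) (P ⧸ V) :=
    Function.Surjective.moduleLeft f hf hsmul
  haveI : IsScalarTower k (MonoidAlgebra k (G ⧸ M.toSubgroup)) (P ⧸ V) := ⟨fun c a y => by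
    obtain ⟨a, rfl⟩ := hf a
    have h1 : c • f a = f (c • a) := (map_smul (projHom k M) c a).symm
    rw [h1, hsmul, hsmul, smul_assoc]⟩
  refine Uniserial.of_surjective_ringHom f hf hsmul (hdata.uniserial ?_
    (IsLocalMod.of_surjective_ringHom f hf hsmul (isLocalMod_quotient hQtop hQ hV hVtop)))
  intro v
  refine (hsmul e v).trans ?_
  obtain ⟨y, rfl⟩ := V.mkQ_surjective v
  rw [← map_smul, hPe y]

end OpenQuotients

section Coinvariants

variable {k : Type} [Field k] {G : Type} [Group G] [TopologicalSpace G]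
  {P : Type} [AddCommGroup P] [Module k P] [Module (CGA k G) P]
  [IsScalarTower k (CGA k G) P] [TopologicalSpace P]

lemma isClosed_coinvKer (N : OpenNormalSubgroup G) :
    IsClosed (coinvKer k G N P : Set P) := by
  rw [coinvKer, Submodule.coe_sInf]
  exact isClosed_biInter fun W hW => hW.1

lemma ofG_smul_sub_mem_coinvKer (N : OpenNormalSubgroup G) {n : G} (hn : n ∈ N.toSubgroup)
    (u : P) : ofG k G n • u - u ∈ coinvKer k G N P :=
  Submodule.mem_sInf.2 fun _ hW => hW.2 n hn u

/-- A quotient of the coinvariants of a pseudocompact local module by an open submodule is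
cyclic, so its dimension is bounded. -/
lemma finrank_quotient_le_card (hP : IsPseudocompactMod k (CGA k G) P)
    {Q : Submodule (CGA k G) P} (hQtop : Q ≠ ⊤)
    (hQ : ∀ W : Submodule (CGA k G) P, IsClosed (W : Set P) → W ≠ ⊤ → W ≤ Q)
    (N : OpenNormalSubgroup G) [Finite (G ⧸ N.toSubgroup)] {V : Submodule (CGA k G) P}
    (hV : IsOpen (V : Set P)) (hNV : coinvKer k G N P ≤ V) :
    Module.finrank k (P ⧸ V) ≤ Nat.card (G ⧸ N.toSubgroup) := by
  have := hP.addGroup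
  have := Fintype.ofFinite (G ⧸ N.toSubgroup)
  obtain ⟨x, hx⟩ : ∃ x, x ∉ Q := by
    by_contra! h
    exact hQtop (eq_top_iff.2 fun x _ => h x)
  obtain ⟨M, hM⟩ := hP.exists_smul_mem_of_projHom_eq_zero hV
  let b : G ⧸ N.toSubgroup → P ⧸ V := fun c => V.mkQ (ofG k G c.out • x)
  let T : Submodule k (P ⧸ V) := Submodule.span k (Set.range b)
  have hspan : ∀ a ∈ Submodule.span k (Set.range (ofG k G)), V.mkQ (a • x) ∈ T := by
    intro a ha
    induction ha using Submodule.span_induction with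
    | mem a ha =>
      obtain ⟨g, rfl⟩ := ha
      have h1 : (g : G ⧸ N.toSubgroup).out⁻¹ * g ∈ N.toSubgroup :=
        QuotientGroup.eq.1 (Quotient.out_eq' (g : G ⧸ N.toSubgroup))
      have h2 := V.smul_mem (ofG k G (g : G ⧸ N.toSubgroup).out)
        (hNV (ofG_smul_sub_mem_coinvKer N h1 x))
      rw [smul_sub, smul_smul, ← map_mul, mul_inv_cancel_left] at h2
      have h3 : V.mkQ (ofG k G g • x) = b g := (Submodule.Quotient.eq V).2 h2
      rw [h3]
      exact Submodule.subset_span ⟨_, rfl⟩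
    | zero => simp
    | add a c _ _ ha hc =>
      rw [add_smul, map_add]
      exact T.add_mem ha hc
    | smul c a _ ha =>
      have h1 : V.mkQ ((c • a) • x) = c • V.mkQ (a • x) := by
        rw [smul_assoc]
        rfl
      rw [h1]
      exact T.smul_mem c ha
  have hcyc : Submodule.span (CGA k G) {x} ⊔ V = ⊤ := by
    by_contra hne
    exact hx (hQ _ (isClosed_of_isOpen_submodule (isOpen_of_le le_sup_right hV)) hne
      (Submodule.mem_sup_left (Submodule.mem_span_singleton_self x)))
  have hT : T = ⊤ := by
    rw [eq_top_iff]
    intro y _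
    obtain ⟨y, rfl⟩ := V.mkQ_surjective y
    obtain ⟨z, hz, v, hv, rfl⟩ := Submodule.mem_sup.1
      (hcyc ▸ Submodule.mem_top : y ∈ Submodule.span (CGA k G) {x} ⊔ V)
    obtain ⟨a, rfl⟩ := Submodule.mem_span_singleton.1 hz
    obtain ⟨a', ha', haa'⟩ := exists_mem_span_projHom_eq M (projHom k M a)
    have h1 := hM (a - a') (by rw [map_sub, haa', sub_self]) x
    have h2 : V.mkQ (a • x + v) = V.mkQ (a' • x) := by
      refine (Submodule.Quotient.eq V).2 ?_
      have h3 : a • x + v - a' • x = (a - a') • x + v := by rw [sub_smul]; abel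
      rw [h3]
      exact V.add_mem h1 hv
    rw [h2]
    exact hspan a' ha'
  have h := finrank_range_le_card (R := k) b
  rw [Set.finrank] at h
  change Module.finrank k T ≤ _ at h
  rwa [hT, finrank_top, ← Nat.card_eq_fintype_card] at h

lemma isOpen_coinvKer (hP : IsPseudocompactMod k (CGA k G) P)
    {Q : Submodule (CGA k G) P} (hQtop : Q ≠ ⊤)
    (hQ : ∀ W : Submodule (CGA k G) P, IsClosed (W : Set P) → W ≠ ⊤ → W ≤ Q)
    (N : OpenNormalSubgroup G) [Finite (G ⧸ N.toSubgroup)] :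
    IsOpen (coinvKer k G N P : Set P) := by
  have := hP.addGroup
  let 𝓓 : Set ℕ := {n | ∃ V : Submodule (CGA k G) P, IsOpen (V : Set P) ∧
    coinvKer k G N P ≤ V ∧ Module.finrank k (P ⧸ V) = n}
  have hbdd : BddAbove 𝓓 := by
    refine ⟨Nat.card (G ⧸ N.toSubgroup), ?_⟩
    rintro _ ⟨V, hV, hNV, rfl⟩
    exact finrank_quotient_le_card hP hQtop hQ N hV hNV
  obtain ⟨V, hV, hNV, hmax⟩ := Nat.sSup_mem (s := 𝓓) ⟨_, ⊤, isOpen_univ, le_top, rfl⟩ hbdd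
  refine isOpen_of_le (fun x hx => ?_) hV
  refine hP.mem_of_forall_open (isClosed_coinvKer N) fun W hW => ?_
  let W' := coinvKer k G N P ⊔ W
  have hW' : IsOpen (W' : Set P) := isOpen_of_le le_sup_right hW
  have hVW : IsOpen ((V ⊓ W' : Submodule (CGA k G) P) : Set P) := hV.inter hW'
  have hle : Module.finrank k (P ⧸ (V ⊓ W')) ≤ Module.finrank k (P ⧸ V) := by
    rw [hmax]
    exact le_csSup hbdd ⟨V ⊓ W', hVW, le_inf hNV le_sup_left, rfl⟩
  have := hP.finite_quotient hVW
  have := hP.finite_quotient hV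
  let g : (P ⧸ (V ⊓ W')) →ₗ[k] (P ⧸ V) :=
    (Submodule.factor (inf_le_left : V ⊓ W' ≤ V)).restrictScalars k
  have hg : Function.Surjective g := Submodule.factor_surjective (inf_le_left : V ⊓ W' ≤ V)
  have heq : Module.finrank k (P ⧸ (V ⊓ W')) = Module.finrank k (P ⧸ V) :=
    le_antisymm hle (LinearMap.finrank_le_finrank_of_surjective hg)
  have hinj : Function.Injective g := (LinearMap.injective_iff_surjective_of_finrank_eq_finrank
    heq).2 hg
  have h1 : g ((V ⊓ W').mkQ x) = g 0 := by
    rw [map_zero]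
    exact (Submodule.Quotient.mk_eq_zero V).2 hx
  exact ((Submodule.Quotient.mk_eq_zero (V ⊓ W')).1 (hinj h1)).2

end Coinvariants

/-- Corollary 5.3(1): every indecomposable projective module of a
block with defect group `ℤ_p` is pro-uniserial: all its coinvariant quotients at
members of the cofinal system `𝒩` are uniserial. -/
theorem indecomposable_projectives_prouniserial_of_Zp_defect
    (p : ℕ) [Fact p.Prime] (k : Type) [Field k] [CharP k p] [IsAlgClosed k]
    (G : Type) [Group G] [TopologicalSpace G] [IsTopologicalGroup G]
    [CompactSpace G] [TotallyDisconnectedSpace G] [T2Space G]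
    (e : CGA k G) (he : IsBlockIdem (CGA k G) e)
    (D : Subgroup G) (hD : IsDefectGroup k G e D)
    (hZp : IsZpGroup G p D)
    (𝒩 : Set (OpenNormalSubgroup G)) (hcof : IsCofinal 𝒩)
    (hgood : ∀ N ∈ 𝒩, GoodN k G e D N)
    (P : Type) [AddCommGroup P] [Module k P] [Module (CGA k G) P]
    [IsScalarTower k (CGA k G) P] [TopologicalSpace P]
    (hPpc : IsPseudocompactMod k (CGA k G) P) (hPproj : IsPCProjective k G P)
    (hPind : IsIndecTop (CGA k G) P) (hPe : InBlock (CGA k G) (X := P) e) :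
    ProUniserial k G 𝒩 P := by
  obtain ⟨Q, -, hQtop, hQ⟩ := hPpc.exists_greatest_open hPproj hPind
  intro N _
  have : Finite (G ⧸ N.toSubgroup) := Subgroup.quotient_finite_of_isOpen _ N.isOpen'
  exact uniserial_openQuotient hZp hcof hgood hPpc hPe hQtop hQ
    (isOpen_coinvKer hPpc hQtop hQ N)

end ProfiniteBlocks
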